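/- arXiv:0908.4595 — 7 statements merged into one kernel-verified Lean document; each statement's English description precedes it below -/
import Mathlib

section
/- For every k > 0 and every w ∈ ℂ, the set of solutions z of the equation z - k/sin(conj z) = w satisfying |Re z| < π/2 (and z ≠ 0, so that sin(conj z) ≠ 0) has at most 6 elements. -/
open Complex Real

/-- The sign of the derivative of the Jacobian at its zeros along the curves. -/
noncomputable def crossingSign (l t : ℝ) : ℝ :=
  (1 + 2 * l) * (1 - l ^ 2 * (1 - t ^ 2) ^ 2) - 2 * (1 + l) * t ^ 2

/-- `t = tanh y` along a branch of `y - v = l * tanh y`, as a function of `l > 0`. -/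
def IsTanhBranch (t : ℝ → ℝ) : Prop :=
  ∀ l, 0 < l → 0 < t l ∧ t l < 1 ∧ 0 < 1 - l * (1 - t l ^ 2) ∧
    HasDerivAt t (t l * (1 - t l ^ 2) / (1 - l * (1 - t l ^ 2))) l

theorem hasDerivAt_crossingSign {t : ℝ → ℝ} (ht : IsTanhBranch t) {l : ℝ} (hl : 0 < l) :
    HasDerivAt (fun l => crossingSign l (t l))
      (2 * (1 - l ^ 2 * (1 - t l ^ 2) ^ 2) - (1 + 2 * l) * (2 * l * (1 - t l ^ 2) ^ 2)
        - 2 * t l ^ 2 + (4 * (1 + 2 * l) * l ^ 2 * (1 - t l ^ 2) - 4 * (1 + l)) * t l *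
          (t l * (1 - t l ^ 2) / (1 - l * (1 - t l ^ 2)))) l := by
  obtain ⟨-, -, -, h⟩ := ht l hl
  unfold crossingSign
  have h1 := (((hasDerivAt_id l).const_mul 2).const_add 1).mul
    ((((hasDerivAt_id l).pow 2).mul (((h.pow 2).const_sub 1).pow 2)).const_sub 1)
  have h2 := (((hasDerivAt_id l).const_add 1).const_mul 2).mul (h.pow 2)
  refine (h1.sub h2).congr_deriv ?_
  simp
  ring

theorem deriv_crossingSign_neg {l t : ℝ} (hl : 0 < l) (hl1 : l < 1) (ht0 : 0 < t) (ht1 : t < 1)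
    (hb : 0 < 1 - l * (1 - t ^ 2)) (h : crossingSign l t = 0) :
    2 * (1 - l ^ 2 * (1 - t ^ 2) ^ 2) - (1 + 2 * l) * (2 * l * (1 - t ^ 2) ^ 2)
        - 2 * t ^ 2 + (4 * (1 + 2 * l) * l ^ 2 * (1 - t ^ 2) - 4 * (1 + l)) * t *
          (t * (1 - t ^ 2) / (1 - l * (1 - t ^ 2))) < 0 := by
  obtain ⟨s, hs⟩ : ∃ s, s = 1 - t ^ 2 := ⟨_, rfl⟩
  have ht2 : t ^ 2 = 1 - s := by linarith
  have hs0 : 0 < s := by nlinarith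
  have hs1 : s < 1 := by nlinarith
  unfold crossingSign at h
  rw [ht2] at h hb ⊢
  have e : (4 * (1 + 2 * l) * l ^ 2 * (1 - (1 - s)) - 4 * (1 + l)) * t *
          (t * (1 - (1 - s)) / (1 - l * (1 - (1 - s)))) =
      (4 * (1 + 2 * l) * l ^ 2 * s - 4 * (1 + l)) * (1 - s) * s / (1 - l * s) := by
    rw [show 1 - (1 - s) = s by ring, ← ht2]; ring
  rw [e]
  have hb' : 0 < 1 - l * s := by linarith
  have key : 2 * (1 - l ^ 2 * (1 - (1 - s)) ^ 2) - (1 + 2 * l) * (2 * l * (1 - (1 - s)) ^ 2)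
        - 2 * (1 - s) + (4 * (1 + 2 * l) * l ^ 2 * s - 4 * (1 + l)) * (1 - s) * s / (1 - l * s)
      = 2 * s * l * (-2 - 2 * s - l * s + 4 * l ^ 2 * s + l ^ 2 * s ^ 2) / (1 - l * s) := by
    rw [eq_div_iff hb'.ne', add_mul, div_mul_cancel₀ _ hb'.ne']
    linear_combination 2 * s * h
  rw [key]
  have h5 : -2 - 2 * s - l * s + 4 * l ^ 2 * s + l ^ 2 * s ^ 2 < 0 := by
    have := mul_pos hl (sub_pos.2 hl1)
    nlinarith [mul_pos this hs0, mul_pos hs0 (sub_pos.2 hs1), mul_pos hs0 (sub_pos.2 hl1),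
      mul_pos this (mul_pos hs0 hs0), mul_pos (mul_pos hs0 hs0) (sub_pos.2 hl1)]
  exact div_neg_of_neg_of_pos (mul_neg_of_pos_of_neg (by positivity) h5) hb'

/-- A function that is negative somewhere after being nonnegative has a zero in between at which
its derivative is nonpositive. -/
theorem exists_zero_deriv_nonpos {f f' : ℝ → ℝ} {a b : ℝ} (hab : a ≤ b)
    (hf : ∀ x ∈ Set.Icc a b, HasDerivAt f (f' x) x) (ha : 0 ≤ f a) (hb : f b < 0) :
    ∃ x ∈ Set.Ico a b, f x = 0 ∧ f' x ≤ 0 := by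
  by_contra! H
  refine hb.not_ge (image_le_of_deriv_right_lt_deriv_boundary' (f := fun _ => (0 : ℝ))
    (f' := fun _ => 0) continuousOn_const (fun x _ => hasDerivWithinAt_const _ _ _) ha
    (fun x hx => (hf x hx).continuousAt.continuousWithinAt)
    (fun x hx => (hf x (Set.Ico_subset_Icc_self hx)).hasDerivWithinAt)
    (fun x hx h => H x hx h.symm) (Set.right_mem_Icc.2 hab))

theorem crossingSign_neg_of_lt {t : ℝ → ℝ} (ht : IsTanhBranch t) {l m : ℝ} (hl : 0 < l)
    (hlm : l < m) (hm : m < 1) (h : crossingSign l (t l) ≤ 0) : crossingSign m (t m) < 0 := by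
  set f' : ℝ → ℝ := fun l => 2 * (1 - l ^ 2 * (1 - t l ^ 2) ^ 2)
    - (1 + 2 * l) * (2 * l * (1 - t l ^ 2) ^ 2)
        - 2 * t l ^ 2 + (4 * (1 + 2 * l) * l ^ 2 * (1 - t l ^ 2) - 4 * (1 + l)) * t l *
          (t l * (1 - t l ^ 2) / (1 - l * (1 - t l ^ 2))) with hf'
  have hd : ∀ x, 0 < x → HasDerivAt (fun l => crossingSign l (t l)) (f' x) x :=
    fun x hx => hasDerivAt_crossingSign ht hx
  have hneg : ∀ x, 0 < x → x < 1 → crossingSign x (t x) = 0 → f' x < 0 := fun x hx hx1 h0 =>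
    deriv_crossingSign_neg hx hx1 (ht x hx).1 (ht x hx).2.1 (ht x hx).2.2.1 h0
  have hle : ∀ x ∈ Set.Icc l m, crossingSign x (t x) ≤ 0 := by
    intro x hx
    by_contra! hx0
    obtain ⟨y, hy, hy0, hy'⟩ := exists_zero_deriv_nonpos (f := fun l => -crossingSign l (t l))
      (f' := fun x => -f' x) hx.1
      (fun y hy => (hd y (hl.trans_le hy.1)).neg) (by simpa using h) (by simpa using hx0)
    have := hneg y (hl.trans_le hy.1) (by linarith [hy.2, hx.2]) (by simpa using hy0)
    simp at hy'
    linarith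
  refine lt_of_le_of_ne (hle m ⟨hlm.le, le_rfl⟩) fun h0 => ?_
  have h1 := hneg m (hl.trans hlm) hm h0
  have h2 := (hd m (hl.trans hlm)).tendsto_slope.mono_left (nhdsLT_le_nhdsNE m)
  have h3 := (h2.eventually (gt_mem_nhds h1)).and (Ioo_mem_nhdsLT hlm)
  obtain ⟨x, hx, hx2⟩ := h3.exists
  rw [slope_def_field, h0, div_lt_iff_of_neg (by linarith [hx2.2])] at hx
  linarith [hle x ⟨hx2.1.le, hx2.2.le⟩]

/-- The parameter `l` along the curve `l * tan x = x - u`. -/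
noncomputable def curveParam (u x : ℝ) : ℝ := (x - u) * Real.cos x / Real.sin x

/-- Minus the Jacobian of the lens map along the curve. -/
noncomputable def curveJac (u : ℝ) (t : ℝ → ℝ) (x : ℝ) : ℝ :=
  curveParam u x ^ 2 + (x - u) ^ 2 * t (curveParam u x) ^ 2 - 1

/-- The squared strength `k ^ 2` expressed through the curve parameter `l`, the displacement
`p = l * tan x` and `t = tanh y`. -/
noncomputable def sqStrength (l p t : ℝ) : ℝ :=
  (p ^ 2 + l ^ 2 * t ^ 2) ^ 2 / ((1 - t ^ 2) * (l ^ 2 + p ^ 2))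

theorem curveParam_pos {u x : ℝ} (h0 : 0 < x) (hu : u < x) (hx : x < Real.pi / 2) :
    0 < curveParam u x :=
  div_pos (mul_pos (sub_pos.2 hu) (Real.cos_pos_of_mem_Ioo ⟨by linarith, hx⟩))
    (Real.sin_pos_of_pos_of_lt_pi h0 (by linarith))

theorem hasDerivAt_curveParam_trig (u : ℝ) {x : ℝ} (hs : Real.sin x ≠ 0) :
    HasDerivAt (curveParam u) ((Real.sin x * Real.cos x - x + u) / Real.sin x ^ 2) x := by
  have h := (((hasDerivAt_id x).sub_const u).mul (Real.hasDerivAt_cos x)).div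
    (Real.hasDerivAt_sin x) hs
  refine h.congr_deriv ?_
  congr 1
  simp
  linear_combination (u - x) * Real.sin_sq_add_cos_sq x

theorem hasDerivAt_curveParam {u x : ℝ} (hs : Real.sin x ≠ 0) (hu : x - u ≠ 0) :
    HasDerivAt (curveParam u)
      ((curveParam u x - curveParam u x ^ 2 - (x - u) ^ 2) / (x - u)) x := by
  refine (hasDerivAt_curveParam_trig u hs).congr_deriv ?_
  unfold curveParam
  field_simp
  linear_combination (x - u) * Real.sin_sq_add_cos_sq x

theorem curveParam_lt {u x y : ℝ} (h0 : 0 < x) (hu : u < x) (hxy : x < y) (hy : y < Real.pi / 2)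
    (h : curveParam u x - curveParam u x ^ 2 - (x - u) ^ 2 < 0) :
    curveParam u y < curveParam u x := by
  have hsx : 0 < Real.sin x := Real.sin_pos_of_pos_of_lt_pi h0 (by linarith)
  have e := (hasDerivAt_curveParam hsx.ne' (sub_pos.2 hu).ne').unique
    (hasDerivAt_curveParam_trig u hsx.ne')
  have h1 : Real.sin x * Real.cos x - x + u < 0 := by
    have : (Real.sin x * Real.cos x - x + u) / Real.sin x ^ 2 < 0 := by
      rw [← e]; exact div_neg_of_neg_of_pos h (sub_pos.2 hu)
    by_contra! h2
    exact absurd this (not_lt.2 (by positivity))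
  have hsin : ∀ z ∈ Set.Icc x y, 0 < Real.sin z := fun z hz =>
    Real.sin_pos_of_pos_of_lt_pi (by linarith [hz.1]) (by linarith [hz.2])
  have hanti : StrictAntiOn (curveParam u) (Set.Icc x y) := by
    refine strictAntiOn_of_deriv_neg (convex_Icc x y) (fun z hz =>
      (hasDerivAt_curveParam_trig u (hsin z hz).ne').continuousAt.continuousWithinAt) ?_
    intro z hz
    rw [interior_Icc] at hz
    have hz' := Set.Ioo_subset_Icc_self hz
    rw [(hasDerivAt_curveParam_trig u (hsin z hz').ne').deriv]
    refine div_neg_of_neg_of_pos ?_ (pow_pos (hsin z hz') 2)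
    have h3 := (abs_le.1 (Real.abs_sin_sub_sin_le (2 * z) (2 * x))).2
    rw [Real.sin_two_mul, Real.sin_two_mul, abs_of_pos (by linarith [hz.1])] at h3
    linarith
  exact hanti (Set.left_mem_Icc.2 hxy.le) (Set.right_mem_Icc.2 hxy.le) hxy

theorem hasDerivAt_curveJac {t : ℝ → ℝ} (ht : IsTanhBranch t) {u x : ℝ} (h0 : 0 < x) (hu : u < x)
    (hx : x < Real.pi / 2) : ∃ D, HasDerivAt (curveJac u t) D x ∧
      (curveJac u t x = 0 → curveParam u x < 1 ∧
        curveParam u x - curveParam u x ^ 2 - (x - u) ^ 2 < 0 ∧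
        ∃ K > 0, D = - K * crossingSign (curveParam u x) (t (curveParam u x))) := by
  have hs : 0 < Real.sin x := Real.sin_pos_of_pos_of_lt_pi h0 (by linarith)
  have hp : 0 < x - u := sub_pos.2 hu
  have hl := curveParam_pos h0 hu hx
  have hd := hasDerivAt_curveParam hs.ne' hp.ne'
  obtain ⟨ht0, ht1, hb, htd⟩ := ht _ hl
  have hd2 := htd.comp x hd
  have hD := ((hd.pow 2).add ((((hasDerivAt_id x).sub_const u).pow 2).mul (hd2.pow 2))).sub_const 1
  refine ⟨_, hD, fun hE => ?_⟩
  unfold curveJac at hE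
  simp only [id, Function.comp, Pi.pow_apply]
  generalize curveParam u x = l at *
  generalize t l = T at *
  generalize x - u = p at *
  have hpt : 0 < p ^ 2 * T ^ 2 := by positivity
  have hl1 : l < 1 := by nlinarith
  have hT1 : 0 < 1 - T ^ 2 := by nlinarith
  have hp2 : p ^ 2 = (1 - l ^ 2) / T ^ 2 := by
    rw [eq_div_iff (by positivity)]; linarith
  have hneg : l - l ^ 2 - p ^ 2 = - ((1 - l) * (1 + l * (1 - T ^ 2)) / T ^ 2) := by
    rw [hp2]; field_simp; ring
  have hneg' : 0 < (1 - l) * (1 + l * (1 - T ^ 2)) / T ^ 2 :=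
    div_pos (mul_pos (by linarith) (by positivity)) (by positivity)
  refine ⟨hl1, by linarith, 2 * (1 - l) / (T ^ 2 * p * (1 - l * (1 - T ^ 2))),
    div_pos (by linarith) (by positivity), ?_⟩
  rw [hneg]
  unfold crossingSign
  have hb' : 1 - l * (1 - T ^ 2) ≠ 0 := hb.ne'
  have hp' : p ≠ 0 := hp.ne'
  have hT' : T ≠ 0 := ht0.ne'
  field_simp
  have hp3 : p ^ 2 * T ^ 2 = 1 - l ^ 2 := by linarith
  linear_combination (2 * l ^ 2 - 4 * l ^ 2 * T ^ 2 + 2 * l ^ 2 * T ^ 4 - 2 + 4 * T ^ 2) * hp3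

theorem hasDerivAt_sqStrength {t : ℝ → ℝ} (ht : IsTanhBranch t) {u x : ℝ} (h0 : 0 < x)
    (hu : u < x) (hx : x < Real.pi / 2) : ∃ K > 0,
      HasDerivAt (fun x => sqStrength (curveParam u x) (x - u) (t (curveParam u x)))
        (-K * curveJac u t x) x := by
  have hs : 0 < Real.sin x := Real.sin_pos_of_pos_of_lt_pi h0 (by linarith)
  have hp : 0 < x - u := sub_pos.2 hu
  have hl := curveParam_pos h0 hu hx
  have hd := hasDerivAt_curveParam hs.ne' hp.ne'
  obtain ⟨ht0, ht1, hb, htd⟩ := ht _ hl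
  have hd2 := htd.comp x hd
  have hd3 := (hasDerivAt_id' x).sub_const u
  have hT1 : 0 < 1 - t (curveParam u x) ^ 2 := by nlinarith
  have hD := (((hd3.pow 2).add ((hd.pow 2).mul (hd2.pow 2))).pow 2).div
    (((hd2.pow 2).const_sub 1).mul ((hd.pow 2).add (hd3.pow 2)))
      (by simp only [Pi.mul_apply, Pi.add_apply, Pi.pow_apply, Function.comp]; positivity)
  refine ⟨2 * sqStrength (curveParam u x) (x - u) (t (curveParam u x)) /
    ((x - u) * (1 - curveParam u x * (1 - t (curveParam u x) ^ 2))), ?_, hD.congr_deriv ?_⟩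
  · unfold sqStrength; positivity
  simp only [Pi.mul_apply, Pi.add_apply, Pi.pow_apply, Function.comp]
  unfold curveJac sqStrength
  generalize curveParam u x = l at *
  generalize t l = T at *
  generalize x - u = p at *
  have hb' : 1 - l * (1 - T ^ 2) ≠ 0 := hb.ne'
  have hT1' := hT1.ne'
  have hlp : l ^ 2 + p ^ 2 ≠ 0 := by positivity
  field_simp
  ring

theorem exists_hasDerivAt_inverse {s : Set ℝ} (hs : IsOpen s) (hc : Convex ℝ s) {f f' : ℝ → ℝ}
    (hf : ∀ x ∈ s, HasDerivAt f (f' x) x) (hf' : ∀ x ∈ s, 0 < f' x) (hpos : ∀ x ∈ s, 0 < f x)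
    (hsurj : ∀ l, 0 < l → ∃ x ∈ s, f x = l) :
    ∃ h : ℝ → ℝ, ∀ l, 0 < l → h l ∈ s ∧ f (h l) = l ∧ HasDerivAt h (f' (h l))⁻¹ l ∧
      ∀ x ∈ s, f x = l → x = h l := by
  have hmono : StrictMonoOn f s := strictMonoOn_of_deriv_pos hc
    (fun x hx => (hf x hx).continuousAt.continuousWithinAt)
    (fun x hx => by
      rw [(hf x (interior_subset hx)).deriv]
      exact hf' x (interior_subset hx))
  choose! h hh using hsurj
  have hmonoh : StrictMonoOn h (Set.Ioi 0) := by
    intro a ha b hb hab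
    rw [← hmono.lt_iff_lt (hh a ha).1 (hh b hb).1, (hh a ha).2, (hh b hb).2]
    exact hab
  have himg : h '' Set.Ioi 0 = s := by
    ext x
    constructor
    · rintro ⟨l, hl, rfl⟩
      exact (hh l hl).1
    · intro hx
      exact ⟨f x, hpos x hx, hmono.injOn (hh _ (hpos x hx)).1 hx (hh _ (hpos x hx)).2⟩
  refine ⟨h, fun l hl => ⟨(hh l hl).1, (hh l hl).2, ?_, fun x hx hxl =>
    hmono.injOn hx (hh l hl).1 (hxl.trans (hh l hl).2.symm)⟩⟩
  have hcont : ContinuousAt h l := hmonoh.continuousAt_of_image_mem_nhds (Ioi_mem_nhds hl)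
    (by rw [himg]; exact hs.mem_nhds (hh l hl).1)
  refine HasDerivAt.of_local_left_inverse hcont (hf _ (hh l hl).1) (hf' _ (hh l hl).1).ne' ?_
  filter_upwards [Ioi_mem_nhds hl] with m hm using (hh m hm).2

theorem hasDerivAt_real_tanh (y : ℝ) : HasDerivAt Real.tanh (1 - Real.tanh y ^ 2) y := by
  have hc := (Real.cosh_pos y).ne'
  have h := (Real.hasDerivAt_sinh y).div (Real.hasDerivAt_cosh y) hc
  have e : Real.tanh = fun y => Real.sinh y / Real.cosh y :=
    funext fun y => Real.tanh_eq_sinh_div_cosh y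
  rw [e]
  refine h.congr_deriv ?_
  field_simp

theorem real_tanh_pos {y : ℝ} (hy : 0 < y) : 0 < Real.tanh y := by
  rw [Real.tanh_eq_sinh_div_cosh]
  exact div_pos (Real.sinh_pos_iff.2 hy) (Real.cosh_pos y)

theorem real_tanh_lt_self {y : ℝ} (hy : 0 < y) : Real.tanh y < y := by
  have hanti : StrictMonoOn (fun y => y - Real.tanh y) (Set.Ici 0) := by
    refine strictMonoOn_of_deriv_pos (convex_Ici 0) (fun z _ =>
      ((hasDerivAt_id z).sub (hasDerivAt_real_tanh z)).continuousAt.continuousWithinAt) ?_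
    intro z hz
    rw [interior_Ici] at hz
    rw [((hasDerivAt_id' z).fun_sub (hasDerivAt_real_tanh z)).deriv]
    have := real_tanh_pos hz
    nlinarith
  have := hanti Set.self_mem_Ici hy.le hy
  simp at this
  linarith

theorem hasDerivAt_coth_param (v : ℝ) {y : ℝ} (hy : Real.sinh y ≠ 0) :
    HasDerivAt (fun y => (y - v) * Real.cosh y / Real.sinh y)
      ((Real.sinh y * Real.cosh y - y + v) / Real.sinh y ^ 2) y := by
  refine ((((hasDerivAt_id y).sub_const v).mul (Real.hasDerivAt_cosh y)).div
    (Real.hasDerivAt_sinh y) hy).congr_deriv ?_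
  congr 1
  simp
  linear_combination (v - y) * Real.cosh_sq y

theorem exists_tanhBranch {v : ℝ} (hv : 0 < v) : ∃ Y : ℝ → ℝ,
    IsTanhBranch (fun l => Real.tanh (Y l)) ∧
      ∀ l, 0 < l → ∀ y, v < y → y - v = l * Real.tanh y → y = Y l := by
  have hsinh : ∀ y ∈ Set.Ioi v, 0 < Real.sinh y := fun y hy => Real.sinh_pos_iff.2 (hv.trans hy)
  have hlin : ∀ y ∈ Set.Ioi v, 0 < Real.sinh y * Real.cosh y - y + v := fun y hy => by
    have h1 := Real.self_lt_sinh_iff.2 (hv.trans hy)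
    have h2 := Real.one_le_cosh y
    nlinarith [hsinh y hy]
  have heq : ∀ l y, y ∈ Set.Ioi v →
      ((y - v) * Real.cosh y / Real.sinh y = l ↔ y - v = l * Real.tanh y) := fun l y hy => by
    have := hsinh y hy
    have hc := Real.cosh_pos y
    rw [Real.tanh_eq_sinh_div_cosh, div_eq_iff this.ne', mul_div_assoc', eq_div_iff hc.ne']
  obtain ⟨Y, hY⟩ := exists_hasDerivAt_inverse isOpen_Ioi (convex_Ioi v)
    (fun y hy => hasDerivAt_coth_param v (hsinh y hy).ne')
    (fun y hy => div_pos (hlin y hy) (pow_pos (hsinh y hy) 2))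
    (fun y hy => div_pos (mul_pos (sub_pos.2 hy) (Real.cosh_pos y)) (hsinh y hy))
    (fun l hl => by
      have hcont : ContinuousOn (fun y => y - v - l * Real.tanh y) (Set.Icc v (v + l)) :=
        fun y _ => (((hasDerivAt_id y).sub_const v).sub
          ((hasDerivAt_real_tanh y).const_mul l)).continuousAt.continuousWithinAt
      have h0 := mul_pos hl (real_tanh_pos hv)
      obtain ⟨y, hy, hy0⟩ := intermediate_value_Icc (by linarith) hcont
        (show (0 : ℝ) ∈ Set.Icc _ _ from ⟨by simp; linarith, by
          have := Real.tanh_lt_one (v + l)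
          simp
          nlinarith⟩)
      have hvy : v < y := lt_of_le_of_ne hy.1 (by
        rintro rfl
        simp at hy0
        rcases hy0 with h | h <;> simp [h] at h0)
      exact ⟨y, hvy, (heq l y hvy).2 (by simp at hy0; linarith)⟩)
  refine ⟨Y, fun l hl => ?_, fun l hl y hy hyl => (hY l hl).2.2.2 y hy ((heq l y hy).2 hyl)⟩
  obtain ⟨h1, h2, h3, -⟩ := hY l hl
  have hs := hsinh _ h1
  have hc := Real.cosh_pos (Y l)
  have hb : 1 - l * (1 - Real.tanh (Y l) ^ 2) =
      (Real.sinh (Y l) * Real.cosh (Y l) - Y l + v) / (Real.sinh (Y l) * Real.cosh (Y l)) := by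
    have h4 := (heq _ _ h1).1 h2
    have h5 := Real.cosh_sq (Y l)
    rw [Real.tanh_eq_sinh_div_cosh] at h4 ⊢
    have h6 : l * Real.sinh (Y l) = (Y l - v) * Real.cosh (Y l) := by
      rw [h4]; field_simp
    field_simp
    linear_combination (-l * Real.sinh (Y l)) * h5 - h6
  refine ⟨real_tanh_pos (hv.trans h1), Real.tanh_lt_one _, ?_,
    ((hasDerivAt_real_tanh (Y l)).comp l h3).congr_deriv ?_⟩
  · rw [hb]; exact div_pos (hlin _ h1) (mul_pos hs hc)
  · beta_reduce
    rw [hb, Real.tanh_eq_sinh_div_cosh]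
    have := (hlin _ h1).ne'
    field_simp

theorem exists_tanBranch {u : ℝ} (hu : 0 < u) : ∃ P : ℝ → ℝ, ∀ l, 0 < l →
    0 < P l ∧ 0 < l ^ 2 + P l ^ 2 - l ∧ HasDerivAt P (-P l / (l ^ 2 + P l ^ 2 - l)) l ∧
      ∀ x, 0 < x → x < Real.pi / 2 → curveParam (-u) x = l → x + u = P l := by
  have hsin : ∀ x ∈ Set.Ioo (-(Real.pi / 2)) 0, Real.sin x < 0 := fun x hx =>
    Real.sin_neg_of_neg_of_neg_pi_lt hx.2 (by linarith [hx.1, Real.pi_pos])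
  have hcos : ∀ x ∈ Set.Ioo (-(Real.pi / 2)) 0, 0 < Real.cos x := fun x hx =>
    Real.cos_pos_of_mem_Ioo ⟨hx.1, by linarith [hx.2, Real.pi_pos]⟩
  have hlin : ∀ x ∈ Set.Ioo (-(Real.pi / 2)) 0, 0 < Real.sin x * Real.cos x - x + u := by
    intro x hx
    have h1 := hsin x hx
    have h2 := Real.cos_le_one x
    have h3 := Real.sin_lt (show 0 < -x by linarith [hx.2])
    rw [Real.sin_neg] at h3
    nlinarith
  obtain ⟨h, hh⟩ := exists_hasDerivAt_inverse isOpen_Ioo (convex_Ioo _ _)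
    (fun x hx => hasDerivAt_curveParam_trig u (hsin x hx).ne)
    (fun x hx => div_pos (hlin x hx) (sq_pos_iff.2 (hsin x hx).ne))
    (fun x hx => div_pos_of_neg_of_neg (mul_neg_of_neg_of_pos (by linarith [hx.2]) (hcos x hx))
      (hsin x hx))
    (fun l hl => by
      have hcont : ContinuousOn (fun x => (x - u) * Real.cos x - l * Real.sin x)
        (Set.Icc (-(Real.pi / 2)) 0) := by fun_prop
      obtain ⟨x, hx, hx0⟩ := intermediate_value_Icc' (by linarith [Real.pi_pos]) hcont
        (show (0 : ℝ) ∈ Set.Icc _ _ from ⟨by simp; linarith, by simp; linarith⟩)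
      simp only at hx0
      have hx1 : x ≠ 0 := by rintro rfl; simp at hx0; linarith
      have hx2 : x ≠ -(Real.pi / 2) := by rintro rfl; simp at hx0; linarith
      have hx' : x ∈ Set.Ioo (-(Real.pi / 2)) 0 :=
        ⟨lt_of_le_of_ne hx.1 hx2.symm, lt_of_le_of_ne hx.2 hx1⟩
      exact ⟨x, hx', by rw [curveParam, div_eq_iff (hsin x hx').ne]; linarith⟩)
  refine ⟨fun l => u - h l, fun l hl => ?_⟩
  obtain ⟨h1, h2, h3, h4⟩ := hh l hl
  have hs := hsin _ h1
  have hp : h l - u < 0 := by linarith [h1.2]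
  have e := (hasDerivAt_curveParam hs.ne hp.ne).unique (hasDerivAt_curveParam_trig u hs.ne)
  rw [h2] at e
  rw [← e] at h3
  have hpos : 0 < (l - l ^ 2 - (h l - u) ^ 2) / (h l - u) := by
    rw [e]
    exact div_pos (hlin _ h1) (sq_pos_iff.2 hs.ne)
  have hneg : l - l ^ 2 - (h l - u) ^ 2 < 0 := by
    by_contra! hc
    exact absurd hpos (not_lt.2 (div_nonpos_of_nonneg_of_nonpos hc hp.le))
  refine ⟨by linarith, by nlinarith, (h3.const_sub u).congr_deriv ?_, fun x hx0 hx1 hx2 => ?_⟩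
  · rw [inv_div, ← neg_div, ← neg_div_neg_eq]
    congr 1 <;> ring
  · have := h4 (-x) ⟨by linarith, by linarith⟩ (by
      rw [← hx2]
      simp only [curveParam, Real.cos_neg, Real.sin_neg]
      rw [div_neg, ← neg_div]
      congr 1
      ring)
    linarith

theorem deriv_eq_zero_of_nonneg_of_eq {f f' : ℝ → ℝ} {x y : ℝ}
    (hf : ∀ z ∈ Set.Icc x y, HasDerivAt f (f' z) z) (hxy : f x = f y)
    (h : ∀ z ∈ Set.Ioo x y, 0 ≤ f' z) : ∀ z ∈ Set.Ioo x y, f' z = 0 := by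
  have hmono : MonotoneOn f (Set.Icc x y) := monotoneOn_of_deriv_nonneg (convex_Icc x y)
    (fun z hz => (hf z hz).continuousAt.continuousWithinAt)
    (fun z hz => (hf z (interior_subset hz)).differentiableAt.differentiableWithinAt)
    (fun z hz => by
      rw [(hf z (interior_subset hz)).deriv]
      exact h z (by rwa [interior_Icc] at hz))
  intro z hz
  have hxy' : x ≤ y := (hz.1.trans hz.2).le
  refine (hf z (Set.Ioo_subset_Icc_self hz)).unique
    ((hasDerivAt_const z (f x)).congr_of_eventuallyEq ?_)
  filter_upwards [Icc_mem_nhds hz.1 hz.2] with w hw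
  exact le_antisymm ((hmono hw (Set.right_mem_Icc.2 hxy') hw.2).trans_eq hxy.symm)
    (hmono (Set.left_mem_Icc.2 hxy') hw hw.1)

theorem curveParam_lt_of_curveJac_eq_zero {t : ℝ → ℝ} (ht : IsTanhBranch t) {u x y : ℝ}
    (h0 : 0 < x) (hu : u < x) (hxy : x < y) (hy : y < Real.pi / 2) (hx : curveJac u t x = 0) :
    curveParam u y < curveParam u x := by
  obtain ⟨D, -, h⟩ := hasDerivAt_curveJac ht h0 hu (hxy.trans hy)
  exact curveParam_lt h0 hu hxy hy (h hx).2.1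

/-- The sign pattern `+ - +` does not occur for `curveJac`. -/
theorem curveJac_nonpos_of_pos_of_neg {t : ℝ → ℝ} (ht : IsTanhBranch t) {u a b c : ℝ}
    (h0 : 0 < a) (hu : u < a) (hab : a < b) (hbc : b < c) (hc : c < Real.pi / 2)
    (ha : 0 < curveJac u t a) (hb : curveJac u t b < 0) : curveJac u t c ≤ 0 := by
  by_contra! hc'
  have hder := fun x (hx : x ∈ Set.Icc a c) =>
    hasDerivAt_curveJac ht (h0.trans_le hx.1) (hu.trans_le hx.1) (hx.2.trans_lt hc)
  choose! D hD hD0 using hder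
  obtain ⟨x, hx, hx0, hxD⟩ := exists_zero_deriv_nonpos hab.le
    (fun z hz => hD z ⟨hz.1, hz.2.trans hbc.le⟩) ha.le hb
  obtain ⟨y, hy, hy0, hyD⟩ := exists_zero_deriv_nonpos (f := fun x => -curveJac u t x)
    (f' := fun x => -D x) hbc.le
    (fun z hz => (hD z ⟨hab.le.trans hz.1, hz.2⟩).neg) (by linarith) (by linarith)
  have hxm : x ∈ Set.Icc a c := ⟨hx.1, (hx.2.trans hbc).le⟩
  have hym : y ∈ Set.Icc a c := ⟨hab.le.trans hy.1, hy.2.le⟩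
  have hy0' : curveJac u t y = 0 := by linarith
  obtain ⟨hx1, hx2, K, hK, hxK⟩ := hD0 x hxm hx0
  obtain ⟨hy1, hy2, L, hL, hyL⟩ := hD0 y hym hy0'
  have hlt := curveParam_lt_of_curveJac_eq_zero ht (h0.trans_le hx.1) (hu.trans_le hx.1)
    (hx.2.trans_le hy.1) (hy.2.trans hc) hx0
  have hpos := curveParam_pos (h0.trans_le hym.1) (hu.trans_le hym.1) (hy.2.trans hc)
  have hny : crossingSign (curveParam u y) (t (curveParam u y)) ≤ 0 := by
    by_contra! h
    nlinarith
  have := crossingSign_neg_of_lt ht hpos hlt hx1 hny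
  nlinarith

theorem exists_curveJac_ne_zero {t : ℝ → ℝ} (ht : IsTanhBranch t) {u x y : ℝ}
    (h0 : 0 < x) (hu : u < x) (hxy : x < y) (hy : y < Real.pi / 2) :
    ∃ z ∈ Set.Ioo x y, curveJac u t z ≠ 0 := by
  by_contra! H
  have hcross : ∀ z ∈ Set.Ioo x y, curveParam u z < 1 ∧
      crossingSign (curveParam u z) (t (curveParam u z)) = 0 := fun z hz => by
    obtain ⟨D, hD, hD0⟩ := hasDerivAt_curveJac ht (h0.trans hz.1) (hu.trans hz.1) (hz.2.trans hy)
    obtain ⟨h1, -, K, hK, rfl⟩ := hD0 (H z hz)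
    refine ⟨h1, ?_⟩
    have := hD.unique ((hasDerivAt_const z (0 : ℝ)).congr_of_eventuallyEq (by
      filter_upwards [Ioo_mem_nhds hz.1 hz.2] with w hw using H w hw))
    simpa [hK.ne'] using this
  obtain ⟨a, ha, hay⟩ := exists_between hxy
  obtain ⟨b, hab, hb⟩ := exists_between hay
  have hlt := curveParam_lt_of_curveJac_eq_zero ht (h0.trans ha) (hu.trans ha) hab (hb.trans hy)
    (H a ⟨ha, hay⟩)
  have hbm : b ∈ Set.Ioo x y := ⟨ha.trans hab, hb⟩
  have := crossingSign_neg_of_lt ht (curveParam_pos (h0.trans hbm.1) (hu.trans hbm.1) (hb.trans hy))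
    hlt (hcross a ⟨ha, hay⟩).1 (hcross b hbm).2.le
  linarith [(hcross a ⟨ha, hay⟩).2]

/-- `sqStrength` along the curve. -/
noncomputable def curveStrength (u : ℝ) (t : ℝ → ℝ) (x : ℝ) : ℝ :=
  sqStrength (curveParam u x) (x - u) (t (curveParam u x))

theorem exists_curveJac_signs {t : ℝ → ℝ} (ht : IsTanhBranch t) {u x y : ℝ}
    (h0 : 0 < x) (hu : u < x) (hxy : x < y) (hy : y < Real.pi / 2)
    (h : curveStrength u t x = curveStrength u t y) :
    (∃ z ∈ Set.Ioo x y, curveJac u t z < 0) ∧ ∃ z ∈ Set.Ioo x y, 0 < curveJac u t z := by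
  have hder := fun z (hz : z ∈ Set.Icc x y) =>
    hasDerivAt_sqStrength ht (h0.trans_le hz.1) (hu.trans_le hz.1) (hz.2.trans_lt hy)
  choose! K hK hder using hder
  obtain ⟨z, hz, hz0⟩ := exists_curveJac_ne_zero ht h0 hu hxy hy
  have hKz := hK z (Set.Ioo_subset_Icc_self hz)
  constructor <;> by_contra! H
  · have := deriv_eq_zero_of_nonneg_of_eq (f := fun z => -curveStrength u t z)
      (fun z hz => (hder z hz).neg) (by simp [h]) (fun z hz => by
        have := mul_nonneg (hK z (Set.Ioo_subset_Icc_self hz)).le (H z hz)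
        linarith) z hz
    simp [hKz.ne', hz0] at this
  · have := deriv_eq_zero_of_nonneg_of_eq hder h (fun z hz => by
        have := mul_nonneg (hK z (Set.Ioo_subset_Icc_self hz)).le (neg_nonneg.2 (H z hz))
        linarith) z hz
    simp [hKz.ne', hz0] at this

theorem curveStrength_four {t : ℝ → ℝ} (ht : IsTanhBranch t) {u K x₁ x₂ x₃ x₄ : ℝ}
    (h0 : 0 < x₁) (hu : u < x₁) (h12 : x₁ < x₂) (h23 : x₂ < x₃) (h34 : x₃ < x₄)
    (h4 : x₄ < Real.pi / 2) (e₁ : curveStrength u t x₁ = K) (e₂ : curveStrength u t x₂ = K)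
    (e₃ : curveStrength u t x₃ = K) (e₄ : curveStrength u t x₄ = K) : False := by
  obtain ⟨-, a, ha, ha'⟩ := exists_curveJac_signs ht h0 hu h12 (by linarith) (e₁.trans e₂.symm)
  obtain ⟨⟨b, hb, hb'⟩, -⟩ := exists_curveJac_signs ht (h0.trans h12) (hu.trans h12) h23
    (by linarith) (e₂.trans e₃.symm)
  obtain ⟨-, c, hc, hc'⟩ := exists_curveJac_signs ht (h0.trans (h12.trans h23))
    (hu.trans (h12.trans h23)) h34 h4 (e₃.trans e₄.symm)
  exact hc'.not_ge (curveJac_nonpos_of_pos_of_neg ht (h0.trans ha.1) (hu.trans ha.1)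
    (ha.2.trans hb.1) (hb.2.trans hc.1) (hc.2.trans h4) ha' hb')

theorem curveJac_nonpos_of_neg_of_neg {t : ℝ → ℝ} (ht : IsTanhBranch t) {u b c : ℝ}
    (hu : u < 0) (h0 : 0 < b) (hbc : b < c) (hc : c < Real.pi / 2)
    (hb : curveJac u t b < 0) : curveJac u t c ≤ 0 := by
  set a := min (b / 2) (Real.arctan (-u)) with ha
  have ha0 : 0 < a := lt_min (by linarith) (Real.arctan_pos.2 (by linarith))
  have hab : a < b := (min_le_left _ _).trans_lt (by linarith)
  refine curveJac_nonpos_of_pos_of_neg ht ha0 (by linarith) hab hbc hc ?_ hb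
  have hcos : 0 < Real.cos a := Real.cos_pos_of_mem_Ioo ⟨by linarith, by linarith⟩
  have hsin : 0 < Real.sin a := Real.sin_pos_of_pos_of_lt_pi ha0 (by linarith)
  have htan : Real.tan a ≤ -u := by
    rw [← Real.tan_arctan (-u)]
    rcases (min_le_right (b / 2) (Real.arctan (-u))).lt_or_eq with h | h
    · exact (Real.tan_lt_tan_of_nonneg_of_lt_pi_div_two ha0.le (Real.arctan_lt_pi_div_two _) h).le
    · exact (congrArg Real.tan h).le
  rw [Real.tan_eq_sin_div_cos, div_le_iff₀ hcos] at htan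
  have hl : 1 < curveParam u a := by
    rw [curveParam, one_lt_div hsin]
    nlinarith
  have := mul_pos (pow_pos (show 0 < a - u by linarith) 2)
    (pow_pos (ht _ (zero_lt_one.trans hl)).1 2)
  unfold curveJac
  nlinarith

theorem continuousAt_curveJac_shift {t : ℝ → ℝ} (ht : IsTanhBranch t) {x : ℝ} (h0 : 0 < x)
    (hx : x < Real.pi / 2) : ContinuousAt (fun u => curveJac u t x) 0 := by
  have h1 : ContinuousAt (fun u => curveParam u x) 0 := by
    unfold curveParam; fun_prop
  have h2 : ContinuousAt (fun u => t (curveParam u x)) 0 :=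
    ContinuousAt.comp (f := fun u => curveParam u x)
      (ht _ (curveParam_pos h0 h0 hx)).2.2.2.continuousAt h1
  exact ((h1.pow 2).add (((continuousAt_const.sub continuousAt_id).pow 2).mul (h2.pow 2))).sub
    continuousAt_const

theorem curveStrength_three {t : ℝ → ℝ} (ht : IsTanhBranch t) {u K x₁ x₂ x₃ : ℝ}
    (hu : u ≤ 0) (h0 : 0 < x₁) (h12 : x₁ < x₂) (h23 : x₂ < x₃)
    (h3 : x₃ < Real.pi / 2) (e₁ : curveStrength u t x₁ = K) (e₂ : curveStrength u t x₂ = K)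
    (e₃ : curveStrength u t x₃ = K) : False := by
  obtain ⟨⟨b, hb, hb'⟩, -⟩ := exists_curveJac_signs ht h0 (hu.trans_lt h0) h12
    (by linarith) (e₁.trans e₂.symm)
  obtain ⟨-, c, hc, hc'⟩ := exists_curveJac_signs ht (h0.trans h12)
    (hu.trans_lt (h0.trans h12)) h23 h3 (e₂.trans e₃.symm)
  have hb0 : 0 < b := h0.trans hb.1
  have hbc : b < c := hb.2.trans hc.1
  have hc3 : c < Real.pi / 2 := hc.2.trans h3
  rcases hu.lt_or_eq with hu | rfl
  · exact hc'.not_ge (curveJac_nonpos_of_neg_of_neg ht hu hb0 hbc hc3 hb')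
  · have hev := ((continuousAt_curveJac_shift ht hb0 (hbc.trans hc3)).eventually
      (gt_mem_nhds hb')).and ((continuousAt_curveJac_shift ht (hb0.trans hbc) hc3).eventually
      (lt_mem_nhds hc'))
    obtain ⟨w, ⟨hw1, hw2⟩, hw⟩ := ((hev.filter_mono nhdsWithin_le_nhds).and
      (self_mem_nhdsWithin (s := Set.Iio (0 : ℝ)))).exists
    exact hw2.not_ge (curveJac_nonpos_of_neg_of_neg ht hw hb0 hbc hc3 hw1)

/-- There is at most one solution in the quadrant opposite to the source; coordinates are reflected
so that the solution is `(x, y)` with `0 < x`, `0 < y` and the source is `(-u, -v)`. -/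
theorem eq_of_sqStrength_eq {u v K : ℝ} (hu : 0 < u) (hv : 0 ≤ v) {x₁ y₁ x₂ y₂ l₁ l₂ : ℝ}
    (hx₁ : 0 < x₁) (hx₁' : x₁ < Real.pi / 2) (hx₂ : 0 < x₂) (hx₂' : x₂ < Real.pi / 2)
    (hy₁ : 0 < y₁) (hy₂ : 0 < y₂)
    (p₁ : curveParam (-u) x₁ = l₁) (p₂ : curveParam (-u) x₂ = l₂)
    (q₁ : y₁ + v = l₁ * Real.tanh y₁) (q₂ : y₂ + v = l₂ * Real.tanh y₂)
    (e₁ : sqStrength l₁ (x₁ + u) (Real.tanh y₁) = K)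
    (e₂ : sqStrength l₂ (x₂ + u) (Real.tanh y₂) = K) : x₁ = x₂ ∧ y₁ = y₂ := by
  obtain ⟨P, hP⟩ := exists_tanBranch hu
  set L : ℝ → ℝ := fun y => (y - -v) * Real.cosh y / Real.sinh y with hL
  have hLt : ∀ y, 0 < y → y + v = L y * Real.tanh y := fun y hy => by
    have := (Real.sinh_pos_iff.2 hy).ne'
    have hc := (Real.cosh_pos y).ne'
    rw [hL, Real.tanh_eq_sinh_div_cosh]
    field_simp
    ring
  have hL1 : ∀ y, 0 < y → 1 < L y := fun y hy => by
    have h1 := real_tanh_lt_self hy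
    have h2 := hLt y hy
    have h3 := real_tanh_pos hy
    by_contra! h
    nlinarith
  have hLeq : ∀ y l, 0 < y → y + v = l * Real.tanh y → l = L y := fun y l hy h =>
    mul_right_cancel₀ (real_tanh_pos hy).ne' (h.symm.trans (hLt y hy))
  have hmono : StrictMonoOn (fun y => sqStrength (L y) (P (L y)) (Real.tanh y)) (Set.Ioi 0) := by
    have key : ∀ y ∈ Set.Ioi (0 : ℝ), ∃ D > 0,
        HasDerivAt (fun y => sqStrength (L y) (P (L y)) (Real.tanh y)) D y := by
      intro y hy
      have hs := Real.sinh_pos_iff.2 hy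
      have hc := Real.cosh_pos y
      have hLd : HasDerivAt L ((1 - L y * (1 - Real.tanh y ^ 2)) / Real.tanh y) y := by
        refine (hasDerivAt_coth_param (-v) hs.ne').congr_deriv ?_
        have h5 := Real.cosh_sq y
        rw [hL, Real.tanh_eq_sinh_div_cosh]
        field_simp
        linear_combination (v + y) * h5
      obtain ⟨hP0, hPd, hPD, -⟩ := hP (L y) (zero_lt_one.trans (hL1 y hy))
      have hp := hPD.comp y hLd
      have ht := hasDerivAt_real_tanh y
      have ht0 := real_tanh_pos hy
      have ht1 : 0 < 1 - Real.tanh y ^ 2 := by nlinarith [Real.tanh_lt_one y]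
      have hl1 := hL1 y hy
      have hD := (((hp.pow 2).add ((hLd.pow 2).mul (ht.pow 2))).pow 2).div
        (((ht.pow 2).const_sub 1).mul ((hLd.pow 2).add (hp.pow 2)))
          (by simp only [Pi.mul_apply, Pi.add_apply, Pi.pow_apply, Function.comp]; positivity)
      refine ⟨2 * sqStrength (L y) (P (L y)) (Real.tanh y) *
        (L y ^ 2 - 1 + P (L y) ^ 2 * Real.tanh y ^ 2) /
        (Real.tanh y * (L y ^ 2 + P (L y) ^ 2 - L y)), ?_, hD.congr_deriv ?_⟩
      · have : 0 < L y ^ 2 - 1 := by nlinarith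
        unfold sqStrength
        positivity
      simp only [Pi.mul_apply, Pi.add_apply, Pi.pow_apply, Function.comp]
      unfold sqStrength
      have hl0 : 0 < L y := by linarith
      clear_value L
      generalize L y = l at *
      generalize P l = p at *
      generalize Real.tanh y = T at *
      have hT1' := ht1.ne'
      have hPd' := hPd.ne'
      have hlp : l ^ 2 + p ^ 2 ≠ 0 := by positivity
      field_simp
      ring
    refine strictMonoOn_of_deriv_pos (convex_Ioi 0) (fun y hy => ?_) (fun y hy => ?_)
    · obtain ⟨D, -, hD⟩ := key y hy
      exact hD.continuousAt.continuousWithinAt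
    · obtain ⟨D, hD0, hD⟩ := key y (interior_subset hy)
      rwa [hD.deriv]
  have hl₁ := hLeq y₁ l₁ hy₁ q₁
  have hl₂ := hLeq y₂ l₂ hy₂ q₂
  have r₁ := (hP l₁ (hl₁ ▸ zero_lt_one.trans (hL1 y₁ hy₁))).2.2.2 x₁ hx₁ hx₁' p₁
  have r₂ := (hP l₂ (hl₂ ▸ zero_lt_one.trans (hL1 y₂ hy₂))).2.2.2 x₂ hx₂ hx₂' p₂
  rw [r₁, hl₁] at e₁
  rw [r₂, hl₂] at e₂
  have hy := hmono.injOn hy₁ hy₂ (e₁.trans e₂.symm)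
  subst hy
  refine ⟨?_, rfl⟩
  rw [hl₁] at r₁
  rw [hl₂] at r₂
  linarith

/-- The lens equation with source `u + v * I` in real coordinates. -/
def lensSolutions (k u v : ℝ) : Set (ℝ × ℝ) :=
  {p | |p.1| < Real.pi / 2 ∧ p ≠ 0 ∧
    (p.1 - u) * (Real.sin p.1 ^ 2 + Real.sinh p.2 ^ 2) = k * (Real.sin p.1 * Real.cosh p.2) ∧
    (p.2 - v) * (Real.sin p.1 ^ 2 + Real.sinh p.2 ^ 2) = k * (Real.cos p.1 * Real.sinh p.2)}

theorem neg_fst_mem_lensSolutions {k u v x y : ℝ} (h : (x, y) ∈ lensSolutions k u v) :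
    (-x, y) ∈ lensSolutions k (-u) v := by
  obtain ⟨h1, h2, h3, h4⟩ := h
  refine ⟨by simpa using h1, fun h => h2 ?_, ?_, ?_⟩
  · simpa using h
  · simp only [Real.sin_neg] at h3 ⊢
    linear_combination -h3
  · simpa using h4

theorem neg_snd_mem_lensSolutions {k u v x y : ℝ} (h : (x, y) ∈ lensSolutions k u v) :
    (x, -y) ∈ lensSolutions k u (-v) := by
  obtain ⟨h1, h2, h3, h4⟩ := h
  refine ⟨h1, fun h => h2 ?_, ?_, ?_⟩
  · simpa using h
  · simpa using h3
  · simp only [Real.sinh_neg] at h4 ⊢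
    linear_combination -h4

theorem encard_lensSolutions_neg_snd (k u v : ℝ) :
    (lensSolutions k u v).encard ≤ (lensSolutions k u (-v)).encard := by
  refine Set.encard_le_encard_of_injOn (f := fun p => (p.1, -p.2))
    (fun p hp => neg_snd_mem_lensSolutions hp) ?_
  rintro ⟨a, b⟩ - ⟨c, d⟩ - h
  simpa using h

theorem encard_le_of_forall_strictMono {α : Type*} [LinearOrder α] {T : Set α} {n : ℕ}
    (h : ∀ f : Fin (n + 1) → α, StrictMono f → ¬ ∀ i, f i ∈ T) : T.encard ≤ n := by
  by_contra! hlt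
  have hle : ((n + 1 : ℕ) : ℕ∞) ≤ T.encard := by
    push_cast
    exact Order.add_one_le_of_lt hlt
  obtain ⟨s, hs, hcard⟩ := Set.exists_subset_encard_eq hle
  have hfin : s.Finite := Set.finite_of_encard_eq_coe hcard
  have hc : hfin.toFinset.card = n + 1 := by
    rw [hfin.encard_eq_coe_toFinset_card] at hcard
    exact_mod_cast hcard
  exact h _ (hfin.toFinset.orderEmbOfFin hc).strictMono fun i =>
    hs (hfin.mem_toFinset.1 (Finset.orderEmbOfFin_mem _ hc i))

/-- A solution in the right half strip lies on both curves. -/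
theorem lensSolutions_curve {k u v x y : ℝ} (hk : 0 < k) (hx : 0 < x)
    (h : (x, y) ∈ lensSolutions k u v) :
    u < x ∧ x < Real.pi / 2 ∧ 0 < curveParam u x ∧ y - v = curveParam u x * Real.tanh y ∧
      sqStrength (curveParam u x) (x - u) (Real.tanh y) = k ^ 2 := by
  obtain ⟨h1, -, h3, h4⟩ := h
  simp only at h1 h3 h4
  have hxpi := (abs_lt.1 h1).2
  have hs := Real.sin_pos_of_pos_of_lt_pi hx (by linarith)
  have hc := Real.cos_pos_of_mem_Ioo (x := x) ⟨by linarith, hxpi⟩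
  have hC := Real.cosh_pos y
  have hD : 0 < Real.sin x ^ 2 + Real.sinh y ^ 2 := by positivity
  have hux : u < x := by
    have : 0 < (x - u) * (Real.sin x ^ 2 + Real.sinh y ^ 2) := by rw [h3]; positivity
    linarith [pos_of_mul_pos_left this hD.le]
  have hl := curveParam_pos hx hux hxpi
  have hsc := Real.sin_sq_add_cos_sq x
  have hch := Real.cosh_sq y
  have e1 : x - u = k * (Real.sin x * Real.cosh y) / (Real.sin x ^ 2 + Real.sinh y ^ 2) := by
    rw [eq_div_iff hD.ne', h3]
  have e2 : y - v = k * (Real.cos x * Real.sinh y) / (Real.sin x ^ 2 + Real.sinh y ^ 2) := by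
    rw [eq_div_iff hD.ne', h4]
  have e3 : curveParam u x =
      k * (Real.cos x * Real.cosh y) / (Real.sin x ^ 2 + Real.sinh y ^ 2) := by
    rw [curveParam, e1]
    field_simp
  refine ⟨hux, hxpi, hl, ?_, ?_⟩
  · rw [e2, e3, Real.tanh_eq_sinh_div_cosh]
    field_simp
  · have e4 : 1 - Real.tanh y ^ 2 = 1 / Real.cosh y ^ 2 := by
      rw [Real.tanh_eq_sinh_div_cosh]
      field_simp
      linarith
    have e5 : curveParam u x ^ 2 + (x - u) ^ 2 =
        k ^ 2 * Real.cosh y ^ 2 / (Real.sin x ^ 2 + Real.sinh y ^ 2) ^ 2 := by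
      rw [e1, e3]
      field_simp
      linarith
    have e6 : (x - u) ^ 2 + curveParam u x ^ 2 * Real.tanh y ^ 2 =
        k ^ 2 / (Real.sin x ^ 2 + Real.sinh y ^ 2) := by
      rw [e1, e3, Real.tanh_eq_sinh_div_cosh]
      field_simp
      linear_combination Real.sin x ^ 2 * hch + Real.sinh y ^ 2 * hsc
    rw [sqStrength, e4, e5, e6]
    field_simp

theorem subsingleton_lensSolutions_snd_eq_zero {k u v : ℝ} (hk : 0 < k) :
    {p ∈ lensSolutions k u v | 0 < p.1 ∧ p.2 = 0}.Subsingleton := by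
  have key : ∀ x, 0 < x → (x, (0 : ℝ)) ∈ lensSolutions k u v →
      (x - u) * Real.sin x = k := fun x hx h => by
    have hs := Real.sin_pos_of_pos_of_lt_pi hx (by linarith [(abs_lt.1 h.1).2])
    have h3 := h.2.2.1
    simp only [Real.sinh_zero, Real.cosh_zero] at h3
    exact mul_right_cancel₀ hs.ne' (by linear_combination h3)
  have lt : ∀ x y, 0 < x → x < y → (x, (0 : ℝ)) ∈ lensSolutions k u v →
      (y, (0 : ℝ)) ∉ lensSolutions k u v := fun x y hx hxy h h' => by
    have hux := (lensSolutions_curve hk hx h).1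
    have hy := (abs_lt.1 h'.1).2
    have hs := Real.sin_pos_of_pos_of_lt_pi hx (by linarith)
    have hss := Real.sin_lt_sin_of_lt_of_le_pi_div_two (by linarith) hy.le hxy
    simp only at hss
    nlinarith [key x hx h, key y (hx.trans hxy) h']
  rintro ⟨x, _⟩ ⟨h, hx, rfl⟩ ⟨y, _⟩ ⟨h', hy, hy0⟩
  simp only at hx hy hy0
  subst hy0
  rcases lt_trichotomy x y with hxy | rfl | hxy
  · exact (lt _ _ hx hxy h h').elim
  · rfl
  · exact (lt _ _ hy hxy h' h).elim

theorem subsingleton_lensSolutions_fst_eq_zero_pos {k u v : ℝ} (hk : 0 < k) :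
    {p ∈ lensSolutions k u v | p.1 = 0 ∧ 0 < p.2}.Subsingleton := by
  have key : ∀ y, 0 < y → ((0 : ℝ), y) ∈ lensSolutions k u v →
      (y - v) * Real.sinh y = k := fun y hy h => by
    have h4 := h.2.2.2
    simp only [Real.sin_zero, Real.cos_zero] at h4
    exact mul_right_cancel₀ (Real.sinh_pos_iff.2 hy).ne' (by linear_combination h4)
  have lt : ∀ x y, 0 < x → x < y → ((0 : ℝ), x) ∈ lensSolutions k u v →
      ((0 : ℝ), y) ∉ lensSolutions k u v := fun x y hx hxy h h' => by
    have hs := Real.sinh_pos_iff.2 hx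
    have hss := Real.sinh_lt_sinh.2 hxy
    have e := key x hx h
    have hvx : 0 < x - v := pos_of_mul_pos_left (e ▸ hk) hs.le
    nlinarith [key y (hx.trans hxy) h']
  rintro ⟨_, x⟩ ⟨h, rfl, hx⟩ ⟨_, y⟩ ⟨h', hy0, hy⟩
  simp only at hx hy hy0
  subst hy0
  rcases lt_trichotomy x y with hxy | rfl | hxy
  · exact (lt _ _ hx hxy h h').elim
  · rfl
  · exact (lt _ _ hy hxy h' h).elim

theorem encard_lensSolutions_fst_eq_zero_le {k u v : ℝ} (hk : 0 < k) :
    {p ∈ lensSolutions k u v | p.1 = 0}.encard ≤ 2 := by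
  have hsub : {p ∈ lensSolutions k u v | p.1 = 0} ⊆
      {p ∈ lensSolutions k u v | p.1 = 0 ∧ 0 < p.2} ∪
        {p ∈ lensSolutions k u v | p.1 = 0 ∧ p.2 < 0} := by
    rintro ⟨x, y⟩ ⟨h, hx⟩
    rcases lt_trichotomy y 0 with hy | hy | hy
    · exact Or.inr ⟨h, hx, hy⟩
    · exact (h.2.1 (Prod.ext hx hy)).elim
    · exact Or.inl ⟨h, hx, hy⟩
  have hneg : {p ∈ lensSolutions k u v | p.1 = 0 ∧ p.2 < 0}.Subsingleton := by
    rintro ⟨a, b⟩ ⟨h, ha, hb⟩ ⟨c, d⟩ ⟨h', hc, hd⟩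
    have := subsingleton_lensSolutions_fst_eq_zero_pos hk
      (x := (a, -b)) ⟨neg_snd_mem_lensSolutions h, ha, neg_pos.2 hb⟩
      (y := (c, -d)) ⟨neg_snd_mem_lensSolutions h', hc, neg_pos.2 hd⟩
    simpa using this
  refine (Set.encard_le_encard hsub).trans ((Set.encard_union_le _ _).trans ?_)
  exact (add_le_add
    (Set.encard_le_one_iff_subsingleton.2 (subsingleton_lensSolutions_fst_eq_zero_pos hk))
    (Set.encard_le_one_iff_subsingleton.2 hneg)).trans_eq one_add_one_eq_two

theorem encard_lensSolutions_curve_le {k u v : ℝ} (hk : 0 < k) (hv : 0 < v) {n : ℕ}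
    (hn : ∀ t, IsTanhBranch t → ∀ f : Fin (n + 1) → ℝ, StrictMono f →
      ¬ ∀ i, (0 < f i ∧ u < f i ∧ f i < Real.pi / 2) ∧ curveStrength u t (f i) = k ^ 2) :
    {p ∈ lensSolutions k u v | 0 < p.1 ∧ 0 < p.2}.encard ≤ n := by
  obtain ⟨Y, hY, hYv⟩ := exists_tanhBranch hv
  have key : ∀ x y, 0 < x → 0 < y → (x, y) ∈ lensSolutions k u v →
      y = Y (curveParam u x) := fun x y hx hy h => by
    obtain ⟨-, -, hl, hy', -⟩ := lensSolutions_curve hk hx h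
    refine hYv _ hl y ?_ hy'
    linarith [mul_pos hl (real_tanh_pos hy)]
  refine le_trans ?_ (encard_le_of_forall_strictMono (T := {x | (0 < x ∧ u < x ∧ x < Real.pi / 2) ∧
    curveStrength u (fun l => Real.tanh (Y l)) x = k ^ 2}) (hn _ hY))
  refine Set.encard_le_encard_of_injOn (f := Prod.fst) ?_ ?_
  · rintro ⟨x, y⟩ ⟨h, hx, hy⟩
    obtain ⟨h1, h2, -, -, h5⟩ := lensSolutions_curve hk hx h
    rw [key x y hx hy h] at h5
    exact ⟨⟨hx, h1, h2⟩, h5⟩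
  · rintro ⟨x, y⟩ ⟨h, hx, hy⟩ ⟨x', y'⟩ ⟨h', hx', hy'⟩ hxx
    simp only at hxx
    subst hxx
    rw [key x y hx hy h, key x y' hx hy' h']

theorem encard_lensSolutions_pos_pos_le_three {k u v : ℝ} (hk : 0 < k) (hv : 0 < v) :
    {p ∈ lensSolutions k u v | 0 < p.1 ∧ 0 < p.2}.encard ≤ 3 :=
  encard_lensSolutions_curve_le (n := 3) hk hv fun _ ht f hf h =>
    curveStrength_four ht (h 0).1.1 (h 0).1.2.1 (hf (a := 0) (b := 1) (by decide))
      (hf (a := 1) (b := 2) (by decide)) (hf (a := 2) (b := 3) (by decide)) (h 3).1.2.2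
      (h 0).2 (h 1).2 (h 2).2 (h 3).2

theorem encard_lensSolutions_pos_pos_le_two {k u v : ℝ} (hk : 0 < k) (hu : u ≤ 0) (hv : 0 < v) :
    {p ∈ lensSolutions k u v | 0 < p.1 ∧ 0 < p.2}.encard ≤ 2 :=
  encard_lensSolutions_curve_le (n := 2) hk hv fun _ ht f hf h =>
    curveStrength_three ht hu (h 0).1.1 (hf (a := 0) (b := 1) (by decide))
      (hf (a := 1) (b := 2) (by decide)) (h 2).1.2.2 (h 0).2 (h 1).2 (h 2).2

theorem subsingleton_lensSolutions_pos_neg {k u v : ℝ} (hk : 0 < k) (hu : u < 0) (hv : 0 ≤ v) :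
    {p ∈ lensSolutions k u v | 0 < p.1 ∧ p.2 < 0}.Subsingleton := by
  rintro ⟨x, y⟩ ⟨h, hx, hy⟩ ⟨x', y'⟩ ⟨h', hx', hy'⟩
  obtain ⟨-, h2, -, h4, h5⟩ := lensSolutions_curve hk hx h
  obtain ⟨-, h2', -, h4', h5'⟩ := lensSolutions_curve hk hx' h'
  obtain ⟨rfl, e⟩ := eq_of_sqStrength_eq (u := -u) (v := v) (K := k ^ 2) (y₁ := -y) (y₂ := -y')
    (neg_pos.2 hu) hv hx h2 hx' h2' (neg_pos.2 hy) (neg_pos.2 hy') rfl rfl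
    (by rw [neg_neg, Real.tanh_neg]; linarith) (by rw [neg_neg, Real.tanh_neg]; linarith)
    (by rw [← h5, sqStrength, sqStrength, Real.tanh_neg]; simp [sub_eq_add_neg])
    (by rw [← h5', sqStrength, sqStrength, Real.tanh_neg]; simp [sub_eq_add_neg])
  rw [neg_inj.1 e]

theorem curveParam_lt_one {u x : ℝ} (hu : 0 ≤ u) (h0 : 0 < x) (hx : x < Real.pi / 2) :
    curveParam u x < 1 := by
  have hs := Real.sin_pos_of_pos_of_lt_pi h0 (by linarith)
  have hc := Real.cos_pos_of_mem_Ioo (x := x) ⟨by linarith, hx⟩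
  rw [curveParam, div_lt_one hs]
  have := Real.lt_tan h0 hx
  rw [Real.tan_eq_sin_div_cos, lt_div_iff₀ hc] at this
  nlinarith

theorem snd_nonneg_of_mem_lensSolutions {k u v x y : ℝ} (hk : 0 < k) (hu : 0 ≤ u) (hv : 0 ≤ v)
    (hx : 0 < x) (h : (x, y) ∈ lensSolutions k u v) : 0 ≤ y := by
  obtain ⟨-, h2, hl, h4, -⟩ := lensSolutions_curve hk hx h
  by_contra! hy
  have h1 := curveParam_lt_one hu hx h2
  have ht := real_tanh_lt_self (neg_pos.2 hy)
  have ht0 := real_tanh_pos (neg_pos.2 hy)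
  rw [Real.tanh_neg] at ht ht0
  nlinarith

theorem setOf_fst_pos_eq {S : Set (ℝ × ℝ)} : {p ∈ S | 0 < p.1} =
    ({p ∈ S | 0 < p.1 ∧ 0 < p.2} ∪ {p ∈ S | 0 < p.1 ∧ p.2 < 0}) ∪
      {p ∈ S | 0 < p.1 ∧ p.2 = 0} := by
  ext p
  have := lt_trichotomy p.2 0
  simp only [Set.mem_union, Set.mem_ofPred_eq]
  tauto

theorem encard_fst_pos_le {S : Set (ℝ × ℝ)} {a b c : ℕ∞}
    (ha : {p ∈ S | 0 < p.1 ∧ 0 < p.2}.encard ≤ a) (hb : {p ∈ S | 0 < p.1 ∧ p.2 < 0}.encard ≤ b)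
    (hc : {p ∈ S | 0 < p.1 ∧ p.2 = 0}.encard ≤ c) : {p ∈ S | 0 < p.1}.encard ≤ a + b + c := by
  rw [setOf_fst_pos_eq]
  exact (Set.encard_union_le _ _).trans
    (add_le_add ((Set.encard_union_le _ _).trans (add_le_add ha hb)) hc)

theorem encard_lensSolutions_pos_neg_eq_zero {k u v : ℝ} (hk : 0 < k) (hu : 0 ≤ u)
    (hv : 0 ≤ v) : {p ∈ lensSolutions k u v | 0 < p.1 ∧ p.2 < 0}.encard ≤ 0 := by
  rw [nonpos_iff_eq_zero, Set.encard_eq_zero, Set.eq_empty_iff_forall_notMem]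
  rintro ⟨x, y⟩ ⟨h, hx, hy⟩
  exact hy.not_ge (snd_nonneg_of_mem_lensSolutions hk hu hv hx h)

theorem encard_lensSolutions_pos_zero_eq_zero {k u v : ℝ} (hk : 0 < k) (hv : 0 < v) :
    {p ∈ lensSolutions k u v | 0 < p.1 ∧ p.2 = 0}.encard ≤ 0 := by
  rw [nonpos_iff_eq_zero, Set.encard_eq_zero, Set.eq_empty_iff_forall_notMem]
  rintro ⟨x, y⟩ ⟨h, hx, rfl⟩
  have := (lensSolutions_curve hk hx h).2.2.2.1
  rw [Real.tanh_zero] at this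
  linarith

/-- For a source on the real axis the reflection `y ↦ -y` exchanges the two quadrants. -/
theorem encard_lensSolutions_pos_pos_le_pos_neg (k u : ℝ) :
    {p ∈ lensSolutions k u 0 | 0 < p.1 ∧ 0 < p.2}.encard ≤
      {p ∈ lensSolutions k u 0 | 0 < p.1 ∧ p.2 < 0}.encard := by
  refine Set.encard_le_encard_of_injOn (f := fun p => (p.1, -p.2)) ?_ ?_
  · rintro ⟨x, y⟩ ⟨h, hx, hy⟩
    exact ⟨by simpa using neg_snd_mem_lensSolutions h, hx, neg_neg_iff_pos.2 hy⟩
  · rintro ⟨a, b⟩ - ⟨c, d⟩ - h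
    simpa using h

theorem encard_lensSolutions_fst_pos_le_three {k u v : ℝ} (hk : 0 < k) (hv : 0 ≤ v) :
    {p ∈ lensSolutions k u v | 0 < p.1}.encard ≤ 3 := by
  rcases hv.eq_or_lt with rfl | hv
  · have h1 : {p ∈ lensSolutions k u 0 | 0 < p.1 ∧ p.2 < 0}.encard ≤ 1 := by
      rcases le_or_gt 0 u with hu | hu
      · exact (encard_lensSolutions_pos_neg_eq_zero hk hu le_rfl).trans zero_le_one
      · exact Set.encard_le_one_iff_subsingleton.2
          (subsingleton_lensSolutions_pos_neg hk hu le_rfl)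
    exact (encard_fst_pos_le ((encard_lensSolutions_pos_pos_le_pos_neg k u).trans h1) h1
      (Set.encard_le_one_iff_subsingleton.2
        (subsingleton_lensSolutions_snd_eq_zero hk))).trans_eq (by norm_num)
  · have h0 := encard_lensSolutions_pos_zero_eq_zero (u := u) hk hv
    rcases le_or_gt 0 u with hu | hu
    · exact (encard_fst_pos_le (encard_lensSolutions_pos_pos_le_three hk hv)
        (encard_lensSolutions_pos_neg_eq_zero hk hu hv.le) h0).trans_eq (by norm_num)
    · exact (encard_fst_pos_le (encard_lensSolutions_pos_pos_le_two hk hu.le hv)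
        (Set.encard_le_one_iff_subsingleton.2
          (subsingleton_lensSolutions_pos_neg hk hu hv.le)) h0).trans_eq (by norm_num)

theorem encard_lensSolutions_fst_pos_le_two {k v : ℝ} (hk : 0 < k) (hv : 0 ≤ v) :
    {p ∈ lensSolutions k 0 v | 0 < p.1}.encard ≤ 2 := by
  have h1 := encard_lensSolutions_pos_neg_eq_zero hk le_rfl hv
  rcases hv.eq_or_lt with rfl | hv
  · exact (encard_fst_pos_le ((encard_lensSolutions_pos_pos_le_pos_neg k 0).trans h1) h1
      (Set.encard_le_one_iff_subsingleton.2
        (subsingleton_lensSolutions_snd_eq_zero hk))).trans (by norm_num)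
  · exact (encard_fst_pos_le (encard_lensSolutions_pos_pos_le_two hk le_rfl hv) h1
      (encard_lensSolutions_pos_zero_eq_zero hk hv)).trans_eq (by norm_num)

theorem encard_lensSolutions_le_add (k u v : ℝ) : (lensSolutions k u v).encard ≤
    {p ∈ lensSolutions k u v | 0 < p.1}.encard + {p ∈ lensSolutions k (-u) v | 0 < p.1}.encard +
      {p ∈ lensSolutions k u v | p.1 = 0}.encard := by
  have hneg : {p ∈ lensSolutions k u v | p.1 < 0}.encard ≤
      {p ∈ lensSolutions k (-u) v | 0 < p.1}.encard := by
    refine Set.encard_le_encard_of_injOn (f := fun p => (-p.1, p.2)) ?_ ?_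
    · rintro ⟨x, y⟩ ⟨h, hx⟩
      exact ⟨neg_fst_mem_lensSolutions h, neg_pos.2 hx⟩
    · rintro ⟨a, b⟩ - ⟨c, d⟩ - h
      simpa using h
  have hsub : lensSolutions k u v ⊆ ({p ∈ lensSolutions k u v | 0 < p.1} ∪
      {p ∈ lensSolutions k u v | p.1 < 0}) ∪ {p ∈ lensSolutions k u v | p.1 = 0} := by
    intro p hp
    have := lt_trichotomy p.1 0
    simp only [Set.mem_union, Set.mem_ofPred_eq]
    tauto
  refine (Set.encard_le_encard hsub).trans ((Set.encard_union_le _ _).trans ?_)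
  gcongr
  exact (Set.encard_union_le _ _).trans (add_le_add le_rfl hneg)

theorem encard_lensSolutions_le_six_of_nonneg {k v : ℝ} (hk : 0 < k) (u : ℝ) (hv : 0 ≤ v) :
    (lensSolutions k u v).encard ≤ 6 := by
  refine (encard_lensSolutions_le_add k u v).trans ?_
  by_cases hu : u = 0
  · subst hu
    rw [neg_zero]
    have h := encard_lensSolutions_fst_pos_le_two hk hv
    exact (add_le_add (add_le_add h h) (encard_lensSolutions_fst_eq_zero_le hk)).trans_eq
      (by norm_num)
  · have h0 : {p ∈ lensSolutions k u v | p.1 = 0} = ∅ := by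
      rw [Set.eq_empty_iff_forall_notMem]
      rintro ⟨x, y⟩ ⟨⟨-, h2, h3, -⟩, hx⟩
      simp only at hx
      subst hx
      simp only [Real.sin_zero] at h3
      have hy : Real.sinh y ≠ 0 := fun hy => h2 (Prod.ext rfl (Real.sinh_eq_zero.1 hy))
      have : u * Real.sinh y ^ 2 = 0 := by linear_combination -h3
      simp_all
    rw [h0, Set.encard_empty, add_zero]
    exact (add_le_add (encard_lensSolutions_fst_pos_le_three hk hv)
      (encard_lensSolutions_fst_pos_le_three hk hv)).trans_eq (by norm_num)

theorem encard_lensSolutions_le_six {k : ℝ} (hk : 0 < k) (u v : ℝ) :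
    (lensSolutions k u v).encard ≤ 6 := by
  rcases le_total 0 v with hv | hv
  · exact encard_lensSolutions_le_six_of_nonneg hk u hv
  · exact (encard_lensSolutions_neg_snd k u v).trans
      (encard_lensSolutions_le_six_of_nonneg hk u (neg_nonneg.2 hv))

theorem normSq_sin (z : ℂ) :
    Complex.normSq (Complex.sin z) = Real.sin z.re ^ 2 + Real.sinh z.im ^ 2 := by
  rw [Complex.sin_eq z, Complex.normSq_apply]
  simp only [← Complex.ofReal_sin, ← Complex.ofReal_cos, ← Complex.ofReal_sinh,
    ← Complex.ofReal_cosh, ← Complex.ofReal_mul, Complex.add_re, Complex.add_im,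
    Complex.ofReal_re, Complex.ofReal_im, Complex.re_ofReal_mul, Complex.im_ofReal_mul,
    Complex.I_re, Complex.I_im]
  linear_combination Real.sinh z.im ^ 2 * Real.sin_sq_add_cos_sq z.re +
    Real.sin z.re ^ 2 * Real.cosh_sq z.im

theorem mem_lensSolutions_of_complex {k : ℝ} {z w : ℂ} (hz : |z.re| < Real.pi / 2) (h0 : z ≠ 0)
    (h : z - (k : ℂ) / Complex.sin (starRingEnd ℂ z) = w) :
    (z.re, z.im) ∈ lensSolutions k w.re w.im := by
  have hD : Real.sin z.re ^ 2 + Real.sinh z.im ^ 2 ≠ 0 := fun hD => by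
    have h1 : Real.sin z.re = 0 := by nlinarith [sq_nonneg (Real.sinh z.im)]
    have h2 : Real.sinh z.im = 0 := by nlinarith [sq_nonneg (Real.sinh z.im)]
    obtain ⟨h3, h4⟩ := abs_lt.1 hz
    refine h0 (Complex.ext ?_ (Real.sinh_eq_zero.1 h2))
    exact (Real.sin_eq_zero_iff_of_lt_of_lt (by linarith) (by linarith)).1 h1
  have e : (k : ℂ) / Complex.sin (starRingEnd ℂ z) =
      ((k / (Real.sin z.re ^ 2 + Real.sinh z.im ^ 2) : ℝ) : ℂ) * Complex.sin z := by
    rw [Complex.sin_conj, div_eq_mul_inv, Complex.inv_def, Complex.conj_conj,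
      Complex.normSq_conj, normSq_sin, div_eq_mul_inv, Complex.ofReal_mul]
    ring
  rw [e, Complex.sin_eq z] at h
  have hre := congrArg Complex.re h
  have him := congrArg Complex.im h
  simp only [← Complex.ofReal_sin, ← Complex.ofReal_cos, ← Complex.ofReal_sinh,
    ← Complex.ofReal_cosh, ← Complex.ofReal_mul, Complex.add_re, Complex.add_im,
    Complex.ofReal_re, Complex.ofReal_im, Complex.re_ofReal_mul, Complex.im_ofReal_mul,
    Complex.I_re, Complex.I_im, Complex.sub_re, Complex.sub_im] at hre him
  refine ⟨hz, fun h => h0 (Complex.ext (congrArg Prod.fst h) (congrArg Prod.snd h)), ?_, ?_⟩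
  · simp only
    rw [← hre]
    field_simp
    ring
  · simp only
    rw [← him]
    field_simp
    ring

/-- The lensing equation `z - k / sin (conj z) = w` has at most 6 solutions `z`
with `|Re z| < π/2` and `z ≠ 0`. -/
theorem lensing_at_most_six_solutions (k : ℝ) (hk : 0 < k) (w : ℂ) :
    {z : ℂ | |z.re| < Real.pi / 2 ∧ z ≠ 0 ∧
      z - (k : ℂ) / Complex.sin (starRingEnd ℂ z) = w}.encard ≤ 6 := by
  refine le_trans ?_ (encard_lensSolutions_le_six hk w.re w.im)
  refine Set.encard_le_encard_of_injOn (f := fun z => (z.re, z.im))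
    (fun z hz => mem_lensSolutions_of_complex hz.1 hz.2.1 hz.2.2) fun a _ b _ h => ?_
  exact Complex.ext (congrArg Prod.fst h) (congrArg Prod.snd h)
end

section
/- Let D ⊆ ℂ be an open connected set, let h and g be functions holomorphic on D, and define the harmonic map f : D → ℂ by f(z) = h(z) + conj(g(z)). Let m be a positive integer and suppose that every w ∈ ℂ has at most m preimages under f in D. Then the set {w ∈ ℂ : f⁻¹({w}) ∩ D has exactly m elements} is open. -/
open Complex

open Filter Topology Metric Set in
/-- If `f = h + conj g` has finite fibres and `w ≠ 0`, then `conj w * h - w * g`, the holomorphic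
function with the same imaginary part as `conj w * f`, is open at each point. -/
lemma nhds_le_map_nhds_of_finite_fibers {D : Set ℂ} (hD : IsOpen D) {h g f : ℂ → ℂ}
    (hh : DifferentiableOn ℂ h D) (hg : DifferentiableOn ℂ g D)
    (hf : ∀ z ∈ D, f z = h z + starRingEnd ℂ (g z))
    (hfin : ∀ w : ℂ, ({z ∈ D | f z = w}).Finite) {q w : ℂ} (hq : q ∈ D) (hw : w ≠ 0) :
    𝓝 (starRingEnd ℂ w * h q - w * g q) ≤
      map (fun z ↦ starRingEnd ℂ w * h z - w * g z) (𝓝 q) := by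
  have hw' : starRingEnd ℂ w ≠ 0 := by simpa using hw
  have hFan : AnalyticAt ℂ (fun z ↦ starRingEnd ℂ w * h z - w * g z) q :=
    ((hh.const_mul _).sub (hg.const_mul _)).analyticAt (hD.mem_nhds hq)
  have hGan : AnalyticAt ℂ (fun z ↦ starRingEnd ℂ w * h z + w * g z) q :=
    ((hh.const_mul _).add (hg.const_mul _)).analyticAt (hD.mem_nhds hq)
  refine hFan.eventually_constant_or_nhds_le_map_nhds.resolve_left fun hF ↦ ?_
  have eq_of : ∀ z ∈ D, starRingEnd ℂ w * h z - w * g z = starRingEnd ℂ w * h q - w * g q →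
      (starRingEnd ℂ w * h z + w * g z).re = (starRingEnd ℂ w * h q + w * g q).re →
      f z = f q := by
    intro z hz hFz hGz
    apply mul_left_cancel₀ hw'
    rw [hf z hz, hf q hq]
    have him := congrArg Complex.im hFz
    apply Complex.ext <;> simp at him hGz ⊢ <;> linarith
  rcases hGan.eventually_constant_or_nhds_le_map_nhds with hG | hG
  · refine infinite_of_mem_nhds q ?_ (hfin (f q))
    filter_upwards [hF, hG, hD.mem_nhds hq] with z hFz hGz hz
    exact ⟨hz, eq_of z hz hFz (by rw [hGz])⟩
  · have himg := hG (image_mem_map (inter_mem hF (hD.mem_nhds hq)))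
    have hc : ContinuousAt (fun t : ℝ ↦ starRingEnd ℂ w * h q + w * g q + t * I) 0 := by fun_prop
    have hpre := hc.preimage_mem_nhds (by simpa using himg)
    refine infinite_of_mem_nhds (0 : ℝ) hpre (Finite.subset
      ((hfin (f q)).image fun z ↦
        (starRingEnd ℂ w * h z + w * g z).im - (starRingEnd ℂ w * h q + w * g q).im) ?_)
    rintro t ⟨z, ⟨hFz, hz⟩, hGz⟩
    refine ⟨z, ⟨hz, eq_of z hz hFz ?_⟩, ?_⟩
    · have := congrArg Complex.re hGz
      simpa using this
    · have := congrArg Complex.im hGz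
      simp at this ⊢
      linarith

open Filter Topology Set in
/-- A complex function open at `q` takes, near `q`, values which differ from its value at `q` by a
positive multiple of a given real number. -/
lemma exists_pos_eq_add_mul_of_nhds_le_map {F : ℂ → ℂ} {q : ℂ} (hF : 𝓝 (F q) ≤ map F (𝓝 q))
    {N : Set ℂ} (hN : N ∈ 𝓝 q) (a : ℝ) : ∃ z ∈ N, ∃ t : ℝ, 0 < t ∧ F z = F q + (a * t : ℝ) := by
  have himg := hF (image_mem_map hN)
  have hc : ContinuousAt (fun t : ℝ ↦ F q + (a * t : ℝ)) 0 := by fun_prop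
  have hpre := hc.preimage_mem_nhds (by simpa using himg)
  obtain ⟨t, ⟨z, hz, hzt⟩, ht⟩ :=
    Filter.nonempty_of_mem
      (inter_mem (mem_nhdsWithin_of_mem_nhds hpre : _ ∈ 𝓝[>] (0 : ℝ)) self_mem_nhdsWithin)
  exact ⟨z, hz, t, ht, hzt⟩

lemma eq_or_eq_neg_of_im_conj_mul_eq_zero {w d : ℂ} (hw : w ≠ 0)
    (him : (starRingEnd ℂ w * d).im = 0) (hn : ‖d‖ = ‖w‖) : d = w ∨ d = -w := by
  have hw' : starRingEnd ℂ w ≠ 0 := by simpa using hw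
  have ha : starRingEnd ℂ w * d = ((starRingEnd ℂ w * d).re : ℂ) := by
    apply Complex.ext <;> simp [him] at *
  have hb : |(starRingEnd ℂ w * d).re| = |‖w‖ ^ 2| := by
    rw [← Real.norm_eq_abs, ← Complex.norm_real, ← ha, norm_mul, RCLike.norm_conj, hn,
      abs_of_nonneg (by positivity)]
    ring
  rcases abs_eq_abs.mp hb with hb | hb
  · left
    apply mul_left_cancel₀ hw'
    rw [ha, hb, Complex.conj_mul']
    push_cast
    rfl
  · right
    apply mul_left_cancel₀ hw'
    rw [ha, hb, mul_neg, Complex.conj_mul']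
    push_cast
    rfl

open Filter Topology Metric Set in
/-- Near each point `z₀`, a harmonic map with finite fibres takes the two values `f z₀ ± w` at
least twice in total, for all sufficiently small `w ≠ 0`. -/
lemma eventually_exists_ne_preimages {D : Set ℂ} (hD : IsOpen D) {h g f : ℂ → ℂ}
    (hh : DifferentiableOn ℂ h D) (hg : DifferentiableOn ℂ g D)
    (hf : ∀ z ∈ D, f z = h z + starRingEnd ℂ (g z))
    (hfin : ∀ w : ℂ, ({z ∈ D | f z = w}).Finite) {z₀ : ℂ} (hz₀ : z₀ ∈ D)
    {V : Set ℂ} (hV : V ∈ 𝓝 z₀) :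
    ∀ᶠ w in 𝓝 (0 : ℂ), w ≠ 0 → ∃ q ∈ D ∩ V, ∃ q' ∈ D ∩ V, q ≠ q' ∧
      (f q = f z₀ + w ∨ f q = f z₀ - w) ∧ (f q' = f z₀ + w ∨ f q' = f z₀ - w) := by
  have hfc : ContinuousOn f D :=
    (hh.continuousOn.add (continuous_conj.comp_continuousOn hg.continuousOn)).congr hf
  have hiso : ({z ∈ D | f z = f z₀} \ {z₀})ᶜ ∈ 𝓝 z₀ :=
    ((hfin (f z₀)).subset sdiff_subset).isClosed.isOpen_compl.mem_nhds (by simp)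
  obtain ⟨r, hr, hball⟩ := nhds_basis_closedBall.mem_iff.mp
    (inter_mem (inter_mem (hD.mem_nhds hz₀) hV) hiso)
  have hBD : closedBall z₀ r ⊆ D := fun z hz ↦ (hball hz).1.1
  have hdc : ContinuousOn (fun z ↦ ‖f z - f z₀‖) (closedBall z₀ r) :=
    ((hfc.mono hBD).sub continuousOn_const).norm
  obtain ⟨ε, hε, hεS⟩ : ∃ ε > 0, ∀ z ∈ sphere z₀ r, ε ≤ ‖f z - f z₀‖ := by
    obtain ⟨x, hx, hmin⟩ := (isCompact_sphere z₀ r).exists_isMinOn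
      (NormedSpace.sphere_nonempty.mpr hr.le) (hdc.mono sphere_subset_closedBall)
    refine ⟨‖f x - f z₀‖, ?_, fun z hz ↦ hmin hz⟩
    rw [gt_iff_lt, norm_pos_iff, sub_ne_zero]
    intro hfx
    have hx' := sphere_subset_closedBall hx
    exact (hball hx').2 ⟨⟨hBD hx', hfx⟩, ne_of_mem_sphere hx hr.ne'⟩
  filter_upwards [ball_mem_nhds 0 hε] with w hwε hw
  rw [mem_ball_zero_iff] at hwε
  set F : ℂ → ℂ := fun z ↦ starRingEnd ℂ w * h z - w * g z with hFdef
  have hFopen : ∀ q ∈ D, 𝓝 (F q) ≤ map F (𝓝 q) := fun q hq ↦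
    nhds_le_map_nhds_of_finite_fibers hD hh hg hf hfin hq hw
  have hFc : ContinuousOn F D :=
    ((hh.const_mul _).sub (hg.const_mul _)).continuousOn
  have hFim : ∀ z ∈ D, (F z).im = (starRingEnd ℂ w * f z).im := by
    intro z hz
    rw [hf z hz]
    simp [hFdef]
    ring
  set K := closedBall z₀ r ∩
    (fun z ↦ ((F z).im, ‖f z - f z₀‖)) ⁻¹' ({(F z₀).im} ×ˢ Iic ‖w‖) with hKdef
  have hK : IsCompact K := by
    refine (isCompact_closedBall z₀ r).of_isClosed_subset ?_ inter_subset_left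
    exact ((continuous_im.comp_continuousOn (hFc.mono hBD)).prodMk hdc).preimage_isClosed_of_isClosed
      isClosed_closedBall (isClosed_singleton.prod isClosed_Iic)
  have hzK : z₀ ∈ K := by
    refine ⟨mem_closedBall_self hr.le, ?_⟩
    simp
  have hpush : ∀ q ∈ K, ‖f q - f z₀‖ < ‖w‖ → ∀ a : ℝ, ∃ z ∈ K, ∃ t : ℝ, 0 < t ∧
      (F z).re = (F q).re + a * t := by
    rintro q ⟨hqB, hqF, hqn⟩ hlt a
    have hqD := hBD hqB
    have hqb : q ∈ ball z₀ r := by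
      refine (lt_or_eq_of_le (mem_closedBall.mp hqB)).resolve_right fun hs ↦ ?_
      linarith [hεS q hs]
    have hn : ∀ᶠ z in 𝓝 q, ‖f z - f z₀‖ < ‖w‖ :=
      ((((hfc.continuousAt (hD.mem_nhds hqD)).sub continuousAt_const).norm).eventually_lt
        continuousAt_const hlt)
    obtain ⟨z, ⟨hzB, hzn⟩, t, ht, hzt⟩ := exists_pos_eq_add_mul_of_nhds_le_map (hFopen q hqD)
      (inter_mem (isOpen_ball.mem_nhds hqb) hn) a
    refine ⟨z, ⟨ball_subset_closedBall hzB, ?_, (show ‖f z - f z₀‖ < ‖w‖ from hzn).le⟩, t, ht, ?_⟩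
    · rw [mem_singleton_iff] at hqF ⊢
      simp only at hqF ⊢
      rw [hzt, ← hqF]
      simp
    · rw [hzt]
      simp
  have hKval : ∀ q ∈ K, ‖f q - f z₀‖ = ‖w‖ → f q = f z₀ + w ∨ f q = f z₀ - w := by
    rintro q ⟨hqB, hqF, hqn⟩ heq
    have him : (starRingEnd ℂ w * (f q - f z₀)).im = 0 := by
      rw [mul_sub, sub_im, ← hFim q (hBD hqB), ← hFim z₀ hz₀, sub_eq_zero]
      exact hqF
    rcases eq_or_eq_neg_of_im_conj_mul_eq_zero hw him heq with hd | hd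
    · left; linear_combination hd
    · right; linear_combination hd
  have hFre : ContinuousOn (fun z ↦ (F z).re) K :=
    continuous_re.comp_continuousOn (hFc.mono (inter_subset_left.trans hBD))
  obtain ⟨q, hqK, hqmax⟩ := hK.exists_isMaxOn ⟨z₀, hzK⟩ hFre
  obtain ⟨q', hqK', hqmin⟩ := hK.exists_isMinOn ⟨z₀, hzK⟩ hFre
  have hq : ‖f q - f z₀‖ = ‖w‖ := by
    refine eq_of_le_of_not_lt hqK.2.2 fun hlt ↦ ?_
    obtain ⟨z, hz, t, ht, hzt⟩ := hpush q hqK hlt 1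
    have : (F z).re ≤ (F q).re := hqmax hz
    linarith
  have hq' : ‖f q' - f z₀‖ = ‖w‖ := by
    refine eq_of_le_of_not_lt hqK'.2.2 fun hlt ↦ ?_
    obtain ⟨z, hz, t, ht, hzt⟩ := hpush q' hqK' hlt (-1)
    have : (F q').re ≤ (F z).re := hqmin hz
    linarith
  refine ⟨q, (hball hqK.1).1, q', (hball hqK'.1).1, ?_, hKval q hqK hq, hKval q' hqK' hq'⟩
  rintro rfl
  obtain ⟨z, hz, t, ht, hzt⟩ := hpush z₀ hzK (by simpa using hw) 1
  have h1 : (F z).re ≤ (F q).re := hqmax hz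
  have h2 : (F q).re ≤ (F z₀).re := hqmin hzK
  linarith

/-- For a planar harmonic map `f = h + conj ∘ g` on a domain `D`, if every point has
at most `m` preimages, then the set of points with exactly `m` preimages is open. -/
theorem harmonic_map_max_preimage_set_isOpen (D : Set ℂ) (hD : IsOpen D)
    (hDconn : IsConnected D) (h g : ℂ → ℂ)
    (hh : DifferentiableOn ℂ h D) (hg : DifferentiableOn ℂ g D)
    (f : ℂ → ℂ) (hf : ∀ z ∈ D, f z = h z + starRingEnd ℂ (g z))
    (m : ℕ) (hm : 0 < m)
    (hmax : ∀ w : ℂ, ({z ∈ D | f z = w}).encard ≤ m) :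
    IsOpen {w : ℂ | ({z ∈ D | f z = w}).encard = m} := by
  have hfin : ∀ w : ℂ, ({z ∈ D | f z = w}).Finite := fun w ↦ Set.finite_of_encard_le_coe (hmax w)
  rw [isOpen_iff_mem_nhds]
  intro w₀ hw₀
  obtain ⟨U, hU, hdisj⟩ := (hfin w₀).t2_separation
  have hev : ∀ᶠ w in nhds (0 : ℂ), ∀ z ∈ {z ∈ D | f z = w₀}, w ≠ 0 →
      ∃ q ∈ D ∩ U z, ∃ q' ∈ D ∩ U z, q ≠ q' ∧
        (f q = f z + w ∨ f q = f z - w) ∧ (f q' = f z + w ∨ f q' = f z - w) :=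
    (hfin w₀).eventually_all.mpr fun z hz ↦
      eventually_exists_ne_preimages hD hh hg hf hfin hz.1 ((hU z).2.mem_nhds (hU z).1)
  have htend : Filter.Tendsto (fun w ↦ w - w₀) (nhds w₀) (nhds 0) := by
    have : ContinuousAt (fun w : ℂ ↦ w - w₀) w₀ := by fun_prop
    simpa [ContinuousAt] using this
  filter_upwards [htend.eventually hev] with w hwev
  rcases eq_or_ne w w₀ with rfl | hne
  · exact hw₀
  have key : ∀ z : {z ∈ D | f z = w₀}, ∃ q ∈ D ∩ U z, ∃ q' ∈ D ∩ U z, q ≠ q' ∧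
      (f q = w ∨ f q = 2 * w₀ - w) ∧ (f q' = w ∨ f q' = 2 * w₀ - w) := by
    rintro ⟨z, hz⟩
    obtain ⟨q, hq, q', hq', hqq, h1, h2⟩ := hwev z hz (sub_ne_zero.mpr hne)
    rw [hz.2, add_sub_cancel, show w₀ - (w - w₀) = 2 * w₀ - w by ring] at h1 h2
    exact ⟨q, hq, q', hq', hqq, h1, h2⟩
  choose q hq q' hq' hqq h1 h2 using key
  let A := {z ∈ D | f z = w} ∪ {z ∈ D | f z = 2 * w₀ - w}
  have hAfin : A.Finite := (hfin _).union (hfin _)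
  let φ : {z ∈ D | f z = w₀} × Bool → A := fun p ↦
    if p.2 then ⟨q p.1, (h1 p.1).imp (⟨(hq p.1).1, ·⟩) (⟨(hq p.1).1, ·⟩)⟩
    else ⟨q' p.1, (h2 p.1).imp (⟨(hq' p.1).1, ·⟩) (⟨(hq' p.1).1, ·⟩)⟩
  have hφU : ∀ p, (φ p : ℂ) ∈ U p.1 := by
    rintro ⟨z, _ | _⟩
    · exact (hq' z).2
    · exact (hq z).2
  have hφ : Function.Injective φ := by
    rintro ⟨z, b⟩ ⟨z', b'⟩ heq
    have hzz : z = z' := by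
      by_contra hzne
      refine Set.disjoint_left.mp
        (hdisj z.2 z'.2 fun hv ↦ hzne (Subtype.ext hv)) (hφU (z, b)) ?_
      rw [heq]
      exact hφU (z', b')
    subst hzz
    cases b <;> cases b' <;> first
    | rfl
    | exact (hqq z (congrArg Subtype.val heq)).elim
    | exact (hqq z (congrArg Subtype.val heq.symm)).elim
  have := hAfin.to_subtype
  have hcard := Nat.card_le_card_of_injective φ hφ
  rw [Nat.card_prod, Nat.card_coe_set_eq, Nat.card_coe_set_eq, Nat.card_eq_fintype_card,
    Fintype.card_bool] at hcard
  have hun := Set.ncard_union_le {z ∈ D | f z = w} {z ∈ D | f z = 2 * w₀ - w}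
  have e0 : ({z ∈ D | f z = w₀}).ncard = m := by
    rw [Set.ncard, show _ = _ from hw₀, ENat.toNat_natCast]
  have e1 := hmax w
  have e2 := hmax (2 * w₀ - w)
  rw [← (hfin _).cast_ncard_eq, Nat.cast_le] at e1 e2
  rw [← (hfin _).cast_ncard_eq, Nat.cast_inj]
  change _ ≤ ({z ∈ D | f z = w} ∪ {z ∈ D | f z = 2 * w₀ - w}).ncard at hcard
  omega
end

section
/- Let k > 0 and let z ∈ ℂ with |Re z| < π/2 and z ≠ 0. If k cos z / sin(z)² = 1 or k cos z / sin(z)² = -1, then Re z = 0 or Im z = 0. (Consequently the tangent to the caustic is never vertical except at points coming from the imaginary axis, and never horizontal except at points coming from the real axis.) -/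
open Complex Real

/-- A root of `c ^ 2 + t * c - 1` with `t` real is real, as the discriminant is positive. -/
lemma im_eq_zero_of_one_sub_sq_eq_ofReal_mul {t : ℝ} {c : ℂ} (h : 1 - c ^ 2 = (t : ℂ) * c) :
    c.im = 0 := by
  have hre := congrArg Complex.re h
  have him := congrArg Complex.im h
  simp [pow_two] at hre him
  by_contra hb
  have ht : t = -2 * c.re := mul_right_cancel₀ hb (by linarith)
  subst ht
  nlinarith [sq_nonneg c.re, sq_nonneg c.im]

lemma re_eq_zero_or_im_eq_zero_of_cos_im_eq_zero {z : ℂ} (hz : |z.re| < Real.pi)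
    (h : (Complex.cos z).im = 0) : z.re = 0 ∨ z.im = 0 := by
  have him : Real.sin z.re * Real.sinh z.im = 0 := by
    simpa [Complex.cos_eq z, ← Complex.ofReal_cos, ← Complex.ofReal_sin, ← Complex.ofReal_cosh,
      ← Complex.ofReal_sinh] using h
  obtain ⟨h₁, h₂⟩ := abs_lt.mp hz
  exact (mul_eq_zero.mp him).imp (Real.sin_eq_zero_iff_of_lt_of_lt h₁ h₂).mp Real.sinh_eq_zero.mp

/-- Lemma 2: if `g'(z) = k cos z / sin(z)² = ±1` for `z` in the strip `|Re z| < π/2`,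
`z ≠ 0`, then `z` lies on the real or the imaginary axis. -/
theorem critical_point_real_derivative_on_axes (k : ℝ) (hk : 0 < k) (z : ℂ)
    (hz : |z.re| < Real.pi / 2) (hz0 : z ≠ 0)
    (heq : (k : ℂ) * Complex.cos z / Complex.sin z ^ 2 = 1 ∨
           (k : ℂ) * Complex.cos z / Complex.sin z ^ 2 = -1) :
    z.re = 0 ∨ z.im = 0 := by
  have hs : Complex.sin z ^ 2 ≠ 0 := fun h => by simp [h] at heq
  have hsq : Complex.sin z ^ 2 = 1 - Complex.cos z ^ 2 := Complex.sin_sq z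
  refine re_eq_zero_or_im_eq_zero_of_cos_im_eq_zero (by linarith [Real.pi_pos]) ?_
  rcases heq with h | h <;> rw [div_eq_iff hs, hsq] at h
  · exact im_eq_zero_of_one_sub_sq_eq_ofReal_mul (t := k) (by linear_combination -h)
  · exact im_eq_zero_of_one_sub_sq_eq_ofReal_mul (t := -k) (by push_cast; linear_combination h)
end

section
/- For every k > 0 the polynomial p(r) = r³ - 3r² + (k² - 1)r - 1 has exactly one positive real root; moreover p(x) < 0 for 0 ≤ x below this root and p(x) > 0 for x above it. -/
/-- For `c` fixed, the quotient of `x³ - 3x² + cx - 1` by `x` is strictly increasing on `(0, ∞)`,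
written here without division. -/
theorem mul_cubic_lt_mul_cubic (c : ℝ) {x y : ℝ} (hx : 0 < x) (hxy : x < y) :
    y * (x ^ 3 - 3 * x ^ 2 + c * x - 1) < x * (y ^ 3 - 3 * y ^ 2 + c * y - 1) := by
  have hmul : 0 < x * y := mul_pos hx (hx.trans hxy)
  have hsq : 0 < (y - x) ^ 2 := pow_pos (sub_pos.mpr hxy) 2
  have hpos : 0 < x * y * (x + y - 3) + 1 := by
    rcases le_or_gt 3 (x + y) with h | h
    · nlinarith [mul_nonneg hmul.le (sub_nonneg.mpr h)]
    · have h₁ := mul_pos hsq (sub_pos.mpr h)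
      have h₂ : 0 ≤ (x + y - 2) ^ 2 * (x + y + 1) := mul_nonneg (sq_nonneg _) (by linarith)
      linarith
  have hprod := mul_pos (sub_pos.mpr hxy) hpos
  linarith

/-- For every `k > 0` the cubic `p(r) = r³ - 3r² + (k² - 1)r - 1` has exactly one
positive real root; `p` is negative on `[0, root)` and positive on `(root, ∞)`. -/
theorem cubic_unique_positive_root (k : ℝ) (hk : 0 < k) :
    ∃ r : ℝ, 0 < r ∧ r ^ 3 - 3 * r ^ 2 + (k ^ 2 - 1) * r - 1 = 0 ∧
      (∀ x : ℝ, 0 < x → x ^ 3 - 3 * x ^ 2 + (k ^ 2 - 1) * x - 1 = 0 → x = r) ∧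
      (∀ x : ℝ, 0 ≤ x → x < r → x ^ 3 - 3 * x ^ 2 + (k ^ 2 - 1) * x - 1 < 0) ∧
      (∀ x : ℝ, r < x → 0 < x ^ 3 - 3 * x ^ 2 + (k ^ 2 - 1) * x - 1) := by
  obtain ⟨r, ⟨hr0, -⟩, hr⟩ : (0 : ℝ) ∈
      (fun x : ℝ => x ^ 3 - 3 * x ^ 2 + (k ^ 2 - 1) * x - 1) '' Set.Icc 0 4 :=
    intermediate_value_Icc (by norm_num) (by fun_prop)
      ⟨by norm_num, by linarith [pow_pos hk 2]⟩
  replace hr : r ^ 3 - 3 * r ^ 2 + (k ^ 2 - 1) * r - 1 = 0 := hr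
  have hrpos : 0 < r := by
    refine hr0.lt_of_ne ?_
    rintro rfl
    norm_num at hr
  have hneg : ∀ x : ℝ, 0 ≤ x → x < r → x ^ 3 - 3 * x ^ 2 + (k ^ 2 - 1) * x - 1 < 0 := by
    intro x hx hxr
    rcases hx.eq_or_lt with rfl | hx
    · norm_num
    · have h := mul_cubic_lt_mul_cubic (k ^ 2 - 1) hx hxr
      rw [hr, mul_zero] at h
      exact (pos_iff_neg_of_mul_neg h).mp hrpos
  have hpos : ∀ x : ℝ, r < x → 0 < x ^ 3 - 3 * x ^ 2 + (k ^ 2 - 1) * x - 1 := by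
    intro x hrx
    have h := mul_cubic_lt_mul_cubic (k ^ 2 - 1) hrpos hrx
    rw [hr, mul_zero] at h
    exact pos_of_mul_pos_right h hrpos.le
  refine ⟨r, hrpos, hr, fun x hx hx0 => ?_, hneg, hpos⟩
  rcases lt_trichotomy x r with h | h | h
  · exact absurd hx0 (hneg x hx.le h).ne
  · exact h
  · exact absurd hx0 (hpos x h).ne'
end

section
/- Let k > 0 and let r be the unique positive real root of p(r) = r³ - 3r² + (k² - 1)r - 1. Then: (a) 1 - k² r + r² ≥ -2r; (b) the following are equivalent: 1 - k² r + r² ≤ 2r; r ≤ 3; k ≥ 2/√3. -/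
/-- Let `r` be the unique positive root of `p(r) = r³ - 3r² + (k²-1)r - 1`. Then
(a) `1 - k²r + r² ≥ -2r`; (b) the conditions `1 - k²r + r² ≤ 2r`, `r ≤ 3` and
`k ≥ 2/√3` are equivalent. -/
theorem cubic_root_inequalities (k : ℝ) (hk : 0 < k) (r : ℝ) (hr : 0 < r)
    (hroot : r ^ 3 - 3 * r ^ 2 + (k ^ 2 - 1) * r - 1 = 0)
    (huniq : ∀ x : ℝ, 0 < x → x ^ 3 - 3 * x ^ 2 + (k ^ 2 - 1) * x - 1 = 0 → x = r) :
    (-2 * r ≤ 1 - k ^ 2 * r + r ^ 2) ∧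
    ((1 - k ^ 2 * r + r ^ 2 ≤ 2 * r) ↔ r ≤ 3) ∧
    ((r ≤ 3) ↔ 2 / Real.sqrt 3 ≤ k) := by
  have hE : 1 - k ^ 2 * r + r ^ 2 = r * (r ^ 2 - 2 * r - 1) := by linarith
  have hK : r * (3 * k ^ 2 - 4) = (3 - r) * (1 + 3 * r ^ 2) := by linarith
  have hsqrt : 2 / Real.sqrt 3 ≤ k ↔ 0 ≤ 3 * k ^ 2 - 4 := by
    rw [← sq_le_sq₀ (by positivity) hk.le, div_pow, Real.sq_sqrt (by norm_num),
      div_le_iff₀ (by norm_num)]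
    constructor <;> intro h <;> linarith
  refine ⟨?_, ?_, ?_⟩
  · rw [hE]
    nlinarith [mul_nonneg hr.le (sq_nonneg (r - 1))]
  · have hfactor : 2 * r - (1 - k ^ 2 * r + r ^ 2) = r * (r + 1) * (3 - r) := by
      rw [hE]
      ring
    rw [← sub_nonneg, hfactor, mul_nonneg_iff_of_pos_left (by positivity), sub_nonneg]
  · rw [hsqrt, ← mul_nonneg_iff_of_pos_left hr, hK,
      mul_nonneg_iff_of_pos_right (by positivity), sub_nonneg]
end

section
/- Let k > 0, let r > 0 satisfy r³ - 3r² + (k² - 1)r - 1 = 0, let t ∈ ℝ satisfy cos(2t) = (1 - k² r + r²)/(2r), and set s = √r·(cos t + i sin t). Then r^{3/2} · Re((1 + s²)²/s³) = 2 cos(t)·(r² - 1). -/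
open Complex Real

/-- With `r` the positive root of the cubic, `cos 2t = (1 - k²r + r²)/(2r)` and
`s = √r e^{it}`, one has `r^{3/2} · Re((1+s²)²/s³) = 2 cos t (r² - 1)`. -/
theorem cusp_sign_formula (k : ℝ) (hk : 0 < k) (r : ℝ) (hr : 0 < r)
    (hroot : r ^ 3 - 3 * r ^ 2 + (k ^ 2 - 1) * r - 1 = 0)
    (t : ℝ) (ht : Real.cos (2 * t) = (1 - k ^ 2 * r + r ^ 2) / (2 * r))
    (s : ℂ)
    (hs : s = (Real.sqrt r : ℂ) * ((Real.cos t : ℂ) + (Real.sin t : ℂ) * Complex.I)) :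
    r ^ ((3 : ℝ) / 2) * ((1 + s ^ 2) ^ 2 / s ^ 3).re =
      2 * Real.cos t * (r ^ 2 - 1) := by
  have hq : 0 < √r := Real.sqrt_pos.2 hr
  have hqC : ((√r : ℝ) : ℂ) ≠ 0 := by exact_mod_cast hq.ne'
  have hqq : ((√r : ℝ) : ℂ) ^ 2 = r := by exact_mod_cast Real.sq_sqrt hr.le
  have hpow : r ^ ((3 : ℝ) / 2) = √r ^ 3 := by
    rw [Real.sqrt_eq_rpow, ← Real.rpow_mul_natCast hr.le]
    norm_num
  have hcos : 2 * Real.cos (2 * t) = r ^ 2 - 2 * r - 1 := by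
    rw [ht]
    field_simp
    linear_combination -hroot
  rw [Real.cos_two_mul] at hcos
  have hcd := Real.sin_sq_add_cos_sq t
  generalize Real.cos t = c at *
  generalize Real.sin t = d at *
  have hunit : ((c : ℂ) + d * I) * (c - d * I) = 1 := by
    have h : (d : ℂ) ^ 2 + (c : ℂ) ^ 2 = 1 := by exact_mod_cast hcd
    linear_combination h - (d : ℂ) ^ 2 * I_sq
  have he : (c : ℂ) + d * I ≠ 0 := left_ne_zero_of_mul_eq_one hunit
  have hinv : ((c : ℂ) + d * I)⁻¹ = c - d * I := inv_eq_of_mul_eq_one_right hunit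
  have hexpand : ((√r ^ 3 : ℝ) : ℂ) * ((1 + s ^ 2) ^ 2 / s ^ 3) =
      (c - d * I) ^ 3 + 2 * r * (c - d * I) + r ^ 2 * (c + d * I) := by
    rw [hs, mul_pow, hqq, ← hinv]
    push_cast
    field_simp
    ring
  rw [hpow, ← Complex.re_ofReal_mul, hexpand]
  simp [pow_succ]
  linear_combination c * hcos - 3 * c * hcd
end

section
/- For every k > 0 there exists a unique c > 0 such that k cosh c = sinh(c)²; for this c one has f(ic) = i(c - tanh c), where f(z) = z - k/sin(conj z), and c - tanh c > 0. (Thus the cusp of the caustic coming from the positive imaginary axis lies on the positive imaginary axis.) -/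
open Complex Real

theorem Real.tanh_lt_self_of_pos {x : ℝ} (hx : 0 < x) : Real.tanh x < x := by
  have hmono : StrictMonoOn (fun t : ℝ => t * Real.cosh t - Real.sinh t) (Set.Ici 0) := by
    refine strictMonoOn_of_hasDerivWithinAt_pos (f' := fun t => t * Real.sinh t)
      (convex_Ici 0) (by fun_prop) (fun t _ => ?_) (fun t ht => ?_)
    · have h := ((hasDerivAt_id t).mul (Real.hasDerivAt_cosh t)).sub (Real.hasDerivAt_sinh t)
      refine (h.congr_deriv ?_).hasDerivWithinAt
      simp
    · rw [interior_Ici] at ht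
      exact mul_pos ht (Real.sinh_pos_iff.2 ht)
  have h := hmono Set.self_mem_Ici hx.le hx
  rw [Real.tanh_eq_sinh_div_cosh, div_lt_iff₀ (Real.cosh_pos x)]
  simpa using h

theorem Real.exists_pos_mul_cosh_eq_sinh_sq {k : ℝ} (hk : 0 < k) :
    ∃ c : ℝ, 0 < c ∧ k * Real.cosh c = Real.sinh c ^ 2 := by
  set x : ℝ := (k + √(k ^ 2 + 4)) / 2 with hx
  have hsq : √(k ^ 2 + 4) ^ 2 = k ^ 2 + 4 := Real.sq_sqrt (by positivity)
  have hxk : k * x = x ^ 2 - 1 := by rw [hx]; linear_combination -hsq / 4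
  have hx0 : 0 < x := by positivity
  have hs : 0 < x ^ 2 - 1 := hxk ▸ mul_pos hk hx0
  refine ⟨Real.arsinh √(x ^ 2 - 1), Real.arsinh_pos_iff.2 (Real.sqrt_pos.2 hs), ?_⟩
  rw [Real.cosh_arsinh, Real.sinh_arsinh, Real.sq_sqrt hs.le, add_sub_cancel,
    Real.sqrt_sq hx0.le, hxk]

theorem Real.eq_of_mul_cosh_eq_sinh_sq {k c d : ℝ} (hk : 0 < k) (hc : 0 < c) (hd : 0 < d)
    (hck : k * Real.cosh c = Real.sinh c ^ 2) (hdk : k * Real.cosh d = Real.sinh d ^ 2) :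
    d = c := by
  rw [Real.sinh_sq] at hck hdk
  have h : (Real.cosh d - Real.cosh c) * (Real.cosh d + Real.cosh c - k) = 0 := by
    linear_combination hck - hdk
  have hne : Real.cosh d + Real.cosh c - k ≠ 0 := by
    nlinarith [Real.one_le_cosh c, Real.one_le_cosh d]
  have hcosh := sub_eq_zero.1 ((mul_eq_zero.1 h).resolve_right hne)
  have habs := le_antisymm (Real.cosh_le_cosh.1 hcosh.le) (Real.cosh_le_cosh.1 hcosh.ge)
  rwa [abs_of_pos hc, abs_of_pos hd] at habs

/-- For every `k > 0` there is a unique `c > 0` with `k cosh c = sinh²c`; for it,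
`f(ic) = i(c - tanh c)` where `f(z) = z - k/sin(conj z)`, and `c - tanh c > 0`. -/
theorem cusp_on_positive_imaginary_axis (k : ℝ) (hk : 0 < k) :
    ∃ c : ℝ, (0 < c ∧ k * Real.cosh c = Real.sinh c ^ 2) ∧
      (∀ d : ℝ, 0 < d → k * Real.cosh d = Real.sinh d ^ 2 → d = c) ∧
      ((c : ℂ) * Complex.I - (k : ℂ) / Complex.sin (starRingEnd ℂ ((c : ℂ) * Complex.I)) =
        ((c - Real.tanh c : ℝ) : ℂ) * Complex.I) ∧
      0 < c - Real.tanh c := by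
  obtain ⟨c, hc, hck⟩ := Real.exists_pos_mul_cosh_eq_sinh_sq hk
  refine ⟨c, ⟨hc, hck⟩, fun d hd hdk => Real.eq_of_mul_cosh_eq_sinh_sq hk hc hd hck hdk, ?_,
    sub_pos.2 (Real.tanh_lt_self_of_pos hc)⟩
  have hsinh : Real.sinh c ≠ 0 := (Real.sinh_pos_iff.2 hc).ne'
  have htanh : Real.tanh c = k / Real.sinh c := by
    rw [Real.tanh_eq_sinh_div_cosh, div_eq_div_iff (Real.cosh_pos c).ne' hsinh]
    linear_combination -hck
  have hsin : Complex.sin (starRingEnd ℂ ((c : ℂ) * Complex.I)) =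
      -((Real.sinh c : ℂ) * Complex.I) := by
    rw [map_mul, Complex.conj_ofReal, Complex.conj_I, mul_neg, Complex.sin_neg,
      Complex.sin_mul_I, Complex.ofReal_sinh]
  have hsinhC : (Real.sinh c : ℂ) ≠ 0 := Complex.ofReal_ne_zero.2 hsinh
  rw [hsin, htanh, Complex.ofReal_sub, Complex.ofReal_div]
  field_simp
  linear_combination (k : ℂ) * Complex.I_sq
end
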